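/- Let f₂ = xy and f₃ = y²z − y³ − x³ in ℂ[x,y,z], and let C = V(f₂³ + f₃²) ⊆ ℙ² (a maximal tame torus sextic with configuration of singularities [Sp₁, A₂]). Then π₁(ℙ² \ C) ≅ ℤ₂ * ℤ₃. -/

import Mathlib

open MvPolynomial

noncomputable section

/-- The complex projective plane, as the projectivization of `ℂ³`. -/
abbrev P2 : Type := Projectivization ℂ (Fin 3 → ℂ)

/-- The complex projective line, as the projectivization of `ℂ²`. -/
abbrev P1 : Type := Projectivization ℂ (Fin 2 → ℂ)

instance : TopologicalSpace P2 :=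
  inferInstanceAs (TopologicalSpace (Quotient (projectivizationSetoid ℂ (Fin 3 → ℂ))))

instance : TopologicalSpace P1 :=
  inferInstanceAs (TopologicalSpace (Quotient (projectivizationSetoid ℂ (Fin 2 → ℂ))))

/-- The zero locus in `ℙ²` of a homogeneous polynomial `g ∈ ℂ[x,y,z]`
(for homogeneous `g` the vanishing of `g` at the chosen representative `x.rep`
is independent of the choice of representative). -/
def V (g : MvPolynomial (Fin 3) ℂ) : Set P2 :=
  {x | eval x.rep g = 0}

/-- The point `[a:b] ∈ ℙ¹`. -/
def pt (a b : ℂ) (hab : ![a, b] ≠ 0) : P1 := Projectivization.mk ℂ ![a, b] hab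

section Helpers
open Topology Set
open scoped unitInterval

section Abstract

variable {X : Type*} [TopologicalSpace X]

/-- Propagation of a property of path classes along paths. -/
theorem propagate {o : X} (Good : ∀ p : X, Path.Homotopic.Quotient o p → Prop)
    (h0 : Good o (.refl o))
    (hl : ∀ p : X, ∃ O : Set X, IsOpen O ∧ p ∈ O ∧ ∀ (a b : X) (γ : Path a b),
      (∀ t, γ t ∈ O) → ∀ c, Good a c → Good b (c.trans (.mk γ))) :
    ∀ p c, Good p c := by
  intro p c
  induction c using Path.Homotopic.Quotient.ind with
  | mk γ =>
  choose O hO hpO hprop using hl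
  obtain ⟨t, t0, tmono, ⟨n, hn⟩, hsub⟩ := exists_monotone_Icc_subset_open_cover_unitInterval
    (c := fun p => γ ⁻¹' O p) (fun p => (hO p).preimage γ.continuous)
    (fun s _ => mem_iUnion.2 ⟨γ s, hpO _⟩)
  have key : ∀ k, Good (γ (t k)) (.mk ((γ.subpath 0 (t k)).cast γ.source.symm rfl)) := by
    intro k
    induction k with
    | zero =>
      rw [t0]
      have : ∀ q (hq : q = o) (δ : Path o q), (∀ s, δ s = o) → Good q (.mk δ) := by
        intro q hq δ hδ
        subst hq
        have : δ = Path.refl _ := by ext s; exact hδ s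
        rw [this]; exact h0
      apply this _ γ.source
      intro s
      simp
    | succ k ih =>
      obtain ⟨i, hi⟩ := hsub k
      have := hprop i _ _ (γ.subpath (t k) (t (k+1))) (by
        intro s
        have : γ.subpath (t k) (t (k+1)) s ∈ range (γ.subpath (t k) (t (k+1))) := ⟨s, rfl⟩
        rw [Path.range_subpath_of_le _ _ _ (tmono (Nat.le_succ k))] at this
        obtain ⟨r, hr, hr'⟩ := this
        rw [← hr']
        exact hi hr) _ ih
      rw [← Path.Homotopic.Quotient.mk_trans] at this
      convert this using 1
      apply Path.Homotopic.Quotient.eq.2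
      have h2 : ((γ.subpath 0 (t k)).trans (γ.subpath (t k) (t (k+1)))).Homotopic
        (γ.subpath 0 (t (k+1))) := ⟨Path.Homotopy.subpathTransSubpath γ _ _ _⟩
      have h3 := (h2.symm).pathCast γ.source.symm rfl
      exact h3
  have := key n
  have h1 : t n = 1 := hn n le_rfl
  rw [h1] at this
  have h4 : ∀ q (hq : q = p) (δ : Path o q), (∀ s, δ s = γ s) → Good q (.mk δ) →
      Good p (.mk γ) := by
    intro q hq δ hδ h
    subst hq
    have : δ = γ := by ext s; exact hδ s
    rwa [← this]
  exact h4 _ γ.target _ (by intro s; simp) this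

/-- The class in `X` of the image of the unique path class between two points. -/
def PP {S : Type*} [TopologicalSpace S] [SimplyConnectedSpace S] (m : C(S, X)) (s s' : S)
    {p q : X} (hp : m s = p) (hq : m s' = q) : Path.Homotopic.Quotient p q :=
  .mk (((PathConnectedSpace.somePath s s').map m.continuous).cast hp.symm hq.symm)

section
variable {S : Type*} [TopologicalSpace S] [SimplyConnectedSpace S] {m : C(S, X)}

theorem PP_eq {s s' : S} {p q : X} (hp : m s = p) (hq : m s' = q) (γ : Path s s')
    (δ : Path p q) (h : ∀ t, δ t = m (γ t)) : PP m s s' hp hq = .mk δ := by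
  have hδ : δ = (γ.map m.continuous).cast hp.symm hq.symm := by
    ext t; exact h t
  rw [hδ]
  exact Path.Homotopic.Quotient.eq.2
    (((SimplyConnectedSpace.paths_homotopic _ γ).map m).pathCast hp.symm hq.symm)

theorem PP_self {s : S} {p : X} (hp : m s = p) (hp' : m s = p) : PP m s s hp hp' = .refl p :=
  PP_eq hp hp (Path.refl s) (Path.refl p) (fun _ => hp.symm)

theorem PP_trans {s s' s'' : S} {p q r : X} (hp : m s = p) (hq : m s' = q) (hr : m s'' = r) :
    (PP m s s' hp hq).trans (PP m s' s'' hq hr) = PP m s s'' hp hr := by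
  subst hp hq hr
  symm
  unfold PP
  rw [← Path.Homotopic.Quotient.mk_trans]
  exact PP_eq rfl rfl ((PathConnectedSpace.somePath s s').trans
    (PathConnectedSpace.somePath s' s'')) _ (fun t => by
      have := Path.map_trans (PathConnectedSpace.somePath s s')
        (PathConnectedSpace.somePath s' s'') m.continuous
      exact (congrArg (fun f => f t) this).symm)

theorem PP_congr {K : Type*} [TopologicalSpace K] [PathConnectedSpace K]
    {S' : Type*} [TopologicalSpace S'] [SimplyConnectedSpace S'] {m' : C(S', X)}
    (J : K → S) (J' : K → S') (hJ : Continuous J) (hJ' : Continuous J')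
    (hm : ∀ k, m (J k) = m' (J' k)) (k k' : K) {p q : X} (hp : m (J k) = p) (hq : m (J k') = q)
    (hp' : m' (J' k) = p) (hq' : m' (J' k') = q) :
    PP m (J k) (J k') hp hq = PP m' (J' k) (J' k') hp' hq' := by
  let δ := PathConnectedSpace.somePath k k'
  rw [PP_eq hp hq (δ.map hJ) (((δ.map hJ).map m.continuous).cast hp.symm hq.symm) (fun _ => rfl)]
  symm
  exact PP_eq hp' hq' (δ.map hJ') _ (fun t => hm _)

/-- invariance under deck transformations -/
theorem PP_deck (θ : S → S) (hθ : Continuous θ) (h : ∀ s, m (θ s) = m s) (s s' : S) {p q : X}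
    (hp : m s = p) (hq : m s' = q) (hp' : m (θ s) = p) (hq' : m (θ s') = q) :
    PP m (θ s) (θ s') hp' hq' = PP m s s' hp hq :=
  PP_congr θ id hθ continuous_id h s s' hp' hq' hp hq

end

/-- A system of set-theoretic local trivialisations of a `G`-torsor gives a monodromy
representation. -/
theorem exists_monodromy {G : Type*} [Group G] {ι : Type*} (base : ι → Set X)
    (hb : ∀ i, IsOpen (base i)) (hcov : ∀ p, ∃ i, p ∈ base i) (s : ι → X → G)
    (hs : ∀ i j, ∀ p ∈ base i ∩ base j, ∀ᶠ q in 𝓝 p, s j q * (s i q)⁻¹ = s j p * (s i p)⁻¹)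
    (o : X) :
    ∃ M : FundamentalGroup X o →* Equiv.Perm G, ∀ (γ : Path o o) (f : I → G),
      (∀ τ : I, ∃ i, γ τ ∈ base i ∧ ∀ᶠ t in 𝓝 τ, s i (γ t) * f t = s i (γ τ) * f τ) →
      M (FundamentalGroup.fromPath (.mk γ)) (f 0) = f 1 := by
  let _ : TopologicalSpace G := ⊥
  have : DiscreteTopology G := ⟨rfl⟩
  choose idx hidx using hcov
  let Z : FiberBundleCore ι X G :=
    { baseSet := base
      isOpen_baseSet := hb
      indexAt := idx
      mem_baseSet_at := hidx
      coordChange := fun i j p g => s j p * (s i p)⁻¹ * g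
      coordChange_self := by intro i x _ v; simp
      continuousOn_coordChange := by
        rintro i j ⟨p, g⟩ ⟨hp, -⟩
        apply ContinuousAt.continuousWithinAt
        have h1 : ∀ᶠ q : X × G in 𝓝 (p, g), s j q.1 * (s i q.1)⁻¹ = s j p * (s i p)⁻¹ :=
          (hs i j p hp).prod_inl_nhds g
        have h2 : ∀ᶠ q : X × G in 𝓝 (p, g), q.2 = g :=
          (show ∀ᶠ g' in 𝓝 g, g' = g by simp [nhds_discrete]).prod_inr_nhds p
        have h3 : (fun q : X × G => s j q.1 * (s i q.1)⁻¹ * q.2) =ᶠ[𝓝 (p, g)]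
            fun _ => s j p * (s i p)⁻¹ * g := by
          filter_upwards [h1, h2] with q h1 h2
          rw [h1, h2]
        exact (continuousAt_const).congr h3.symm
      coordChange_comp := by intro i j k x _ v; group }
  have cov : IsCoveringMap Z.proj := FiberBundle.isCoveringMap (F := G) (E := Z.Fiber)
  let e : (Z.proj ⁻¹' {o}) ≃ G :=
    { toFun := fun x => (s (idx x.1.1) x.1.1)⁻¹ * (show G from x.1.2)
      invFun := fun g => ⟨⟨o, (s (idx o) o * g : G)⟩, rfl⟩
      left_inv := by
        rintro ⟨⟨x, g⟩, hx⟩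
        have hx' : x = o := hx
        subst hx'
        apply Subtype.ext
        have h : s (idx x) x * ((s (idx x) x)⁻¹ * (show G from g)) = (show G from g) :=
          mul_inv_cancel_left _ _
        exact congrArg (fun g' : G => (⟨x, g'⟩ : Z.TotalSpace)) h
      right_inv := by intro g; simp }
  refine ⟨(e.permCongrHom.toMonoidHom).comp (cov.monodromyPerm o), ?_⟩
  intro γ f hf
  let Γ : I → Z.TotalSpace := fun t => ⟨γ t, (s (idx (γ t)) (γ t) * f t : G)⟩
  have hΓ : Continuous Γ := by
    rw [continuous_iff_continuousAt]
    intro τ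
    obtain ⟨i, hi, hc⟩ := hf τ
    have hpre : ∀ᶠ t in 𝓝 τ, γ t ∈ base i :=
      γ.continuous.continuousAt.eventually ((hb i).mem_nhds hi)
    have hsrc : Γ ⁻¹' (Z.localTriv i).source ∈ 𝓝 τ := hpre
    rw [(Z.localTriv i).toOpenPartialHomeomorph.continuousAt_iff_continuousAt_comp_left hsrc]
    have h4 : (fun t => (γ t, s i (γ τ) * f τ)) =ᶠ[𝓝 τ]
        ((Z.localTriv i).toOpenPartialHomeomorph ∘ Γ) := by
      filter_upwards [hc] with t ht
      have : (Z.localTriv i).toOpenPartialHomeomorph (Γ t) =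
        (γ t, s i (γ t) * (s (idx (γ t)) (γ t))⁻¹ * (s (idx (γ t)) (γ t) * f t)) := rfl
      rw [Function.comp_apply, this, ← ht]
      simp [mul_assoc]
    exact (γ.continuous.continuousAt.prodMk continuousAt_const).congr h4
  let ΓP : Path (Γ 0) (Γ 1) := ⟨⟨Γ, hΓ⟩, rfl, rfl⟩
  have h0 : Z.proj (Γ 0) = o := γ.source
  have h1 : Z.proj (Γ 1) = o := γ.target
  have hm : cov.monodromy (.mk γ) ⟨Γ 0, h0⟩ = ⟨Γ 1, h1⟩ := by
    apply cov.monodromy_eq_of_map_eq (.mk ΓP)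
    refine congrArg Path.Homotopic.Quotient.mk ?_
    ext t
    rfl
  have e0 : e ⟨Γ 0, h0⟩ = f 0 := by simp [e, Γ]
  have e1 : e ⟨Γ 1, h1⟩ = f 1 := by simp [e, Γ]
  have : e (cov.monodromy (.mk γ) (e.symm (f 0))) = f 1 := by
    rw [← e0, Equiv.symm_apply_apply, hm, e1]
  exact this

end Abstract

section Top

def f2 (v : Fin 3 → ℂ) : ℂ := v 0 * v 1
def f3 (v : Fin 3 → ℂ) : ℂ := v 1 ^ 2 * v 2 - v 1 ^ 3 - v 0 ^ 3
def DD (v : Fin 3 → ℂ) : ℂ := f2 v ^ 3 + f3 v ^ 2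

theorem f2_smul (c : ℂ) (v) : f2 (c • v) = c ^ 2 * f2 v := by simp [f2]; ring
theorem f3_smul (c : ℂ) (v) : f3 (c • v) = c ^ 3 * f3 v := by simp [f3]; ring
theorem DD_smul (c : ℂ) (v) : DD (c • v) = c ^ 6 * DD v := by
  simp only [DD, f2_smul, f3_smul]; ring

@[fun_prop] theorem continuous_f2 : Continuous f2 := by unfold f2; fun_prop
@[fun_prop] theorem continuous_f3 : Continuous f3 := by unfold f3; fun_prop

theorem ne_zero_of_DD {v : Fin 3 → ℂ} (h : DD v ≠ 0) : v ≠ 0 := by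
  rintro rfl; simp [DD, f2, f3] at h

/-- complement of the sextic -/
def UU : Set P2 := {p | DD p.rep ≠ 0}

theorem rep_mk (v : Fin 3 → ℂ) (hv : v ≠ 0) :
    ∃ c : ℂ, c ≠ 0 ∧ (Projectivization.mk ℂ v hv).rep = c • v := by
  obtain ⟨a, ha⟩ := Projectivization.exists_smul_eq_mk_rep ℂ v hv
  exact ⟨a, a.ne_zero, ha.symm⟩

def mkU (v : Fin 3 → ℂ) (h : DD v ≠ 0) : UU :=
  ⟨Projectivization.mk ℂ v (ne_zero_of_DD h), by
    obtain ⟨c, hc, h'⟩ := rep_mk v (ne_zero_of_DD h)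
    show DD _ ≠ 0
    rw [h', DD_smul]
    exact mul_ne_zero (pow_ne_zero _ hc) h⟩

abbrev rep (p : UU) : Fin 3 → ℂ := p.1.rep

theorem rep_mkU (v : Fin 3 → ℂ) (h : DD v ≠ 0) : ∃ c : ℂ, c ≠ 0 ∧ rep (mkU v h) = c • v :=
  rep_mk v _

theorem mkU_eq {v w : Fin 3 → ℂ} (hv : DD v ≠ 0) (hw : DD w ≠ 0) (c : ℂ) (h : c • w = v) :
    mkU v hv = mkU w hw := by
  apply Subtype.ext
  exact (Projectivization.mk_eq_mk_iff' _ _ _ _ _).2 ⟨c, h⟩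

theorem mkU_rep (p : UU) : mkU (rep p) p.2 = p := by
  apply Subtype.ext
  exact Projectivization.mk_rep _

theorem continuous_mkP : Continuous (fun v : {v : Fin 3 → ℂ // v ≠ 0} =>
    (Projectivization.mk ℂ v.1 v.2 : P2)) := continuous_quotient_mk'

theorem cont_mkU {S : Type*} [TopologicalSpace S] (f : S → Fin 3 → ℂ) (hf : Continuous f)
    (hD : ∀ s, DD (f s) ≠ 0) : Continuous fun s => mkU (f s) (hD s) := by
  apply Continuous.subtype_mk
  exact continuous_mkP.comp (hf.subtype_mk (fun s => ne_zero_of_DD (hD s)))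

theorem isOpen_image_mk (O : Set (Fin 3 → ℂ)) (hO : IsOpen O) :
    IsOpen {p : P2 | ∃ v, ∃ hv : v ≠ 0, v ∈ O ∧ Projectivization.mk ℂ v hv = p} := by
  have hq : IsQuotientMap (fun v : {v : Fin 3 → ℂ // v ≠ 0} =>
    (Projectivization.mk ℂ v.1 v.2 : P2)) := isQuotientMap_quotient_mk'
  rw [← hq.isOpen_preimage]
  have : (fun v : {v : Fin 3 → ℂ // v ≠ 0} =>
    (Projectivization.mk ℂ v.1 v.2 : P2)) ⁻¹'
      {p : P2 | ∃ v, ∃ hv : v ≠ 0, v ∈ O ∧ Projectivization.mk ℂ v hv = p} =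
      ⋃ c : ℂ, {w | c • w.1 ∈ O ∧ c ≠ 0} := by
    ext w
    simp only [mem_preimage, mem_ofPred_eq, mem_iUnion]
    constructor
    · rintro ⟨v, hv, hvO, h⟩
      obtain ⟨c, hc⟩ := (Projectivization.mk_eq_mk_iff' _ _ _ _ _).1 h
      refine ⟨c, by rwa [hc], ?_⟩
      rintro rfl
      exact hv (by rw [← hc]; simp)
    · rintro ⟨c, hc, h0⟩
      refine ⟨c • w.1, smul_ne_zero h0 w.2, hc, ?_⟩
      exact (Projectivization.mk_eq_mk_iff' _ _ _ _ _).2 ⟨c, rfl⟩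
  rw [this]
  apply isOpen_iUnion
  intro c
  by_cases hc : c = 0
  · simp [hc]
  · simp only [hc, ne_eq, not_false_eq_true, and_true]
    exact hO.preimage (by fun_prop)

theorem ev_rep (P : (Fin 3 → ℂ) → Prop) (hP : ∀ c : ℂ, c ≠ 0 → ∀ v, P v → P (c • v)) (p : UU)
    (h : ∀ᶠ v in 𝓝 (rep p), P v) : ∀ᶠ q in 𝓝 p, P (rep q) := by
  obtain ⟨O, hOP, hO, hpO⟩ := eventually_nhds_iff.1 h |>.imp fun _ h => h
  have h1 : ∀ᶠ q : P2 in 𝓝 p.1, P q.rep := by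
    filter_upwards [(isOpen_image_mk O hO).mem_nhds
      ⟨p.1.rep, p.1.rep_nonzero, hpO, Projectivization.mk_rep _⟩]
    rintro q ⟨v, hv, hvO, rfl⟩
    obtain ⟨c, hc, h'⟩ := rep_mk v hv
    rw [h']
    exact hP c hc v (hOP v hvO)
  exact continuous_subtype_val.continuousAt.eventually h1

theorem contAt_rep {Y : Type*} [TopologicalSpace Y] (F : (Fin 3 → ℂ) → Y)
    (hF : ∀ c : ℂ, c ≠ 0 → ∀ v, F (c • v) = F v) (p : UU)
    (h : ContinuousAt F (rep p)) : ContinuousAt (fun q : UU => F (rep q)) p := by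
  intro W hW
  exact ev_rep (fun v => F v ∈ W) (fun c hc v hv => by rwa [hF c hc]) p (h hW)

theorem isOpen_rep (P : (Fin 3 → ℂ) → Prop) (hP : ∀ c : ℂ, c ≠ 0 → ∀ v, P v → P (c • v))
    (h : ∀ v, P v → ∀ᶠ w in 𝓝 v, P w) : IsOpen {p : UU | P (rep p)} := by
  rw [isOpen_iff_mem_nhds]
  intro p hp
  exact ev_rep P hP p (h _ hp)

/-- affine coordinates -/
theorem DD_aff {x w : ℂ} (h : x ^ 3 + w ^ 2 ≠ 0) : DD ![x, 1, w + 1 + x ^ 3] ≠ 0 := by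
  have : DD ![x, 1, w + 1 + x ^ 3] = x ^ 3 + w ^ 2 := by
    simp [DD, f2, f3]; ring
  rwa [this]

def aff (x w : ℂ) (h : x ^ 3 + w ^ 2 ≠ 0) : UU := mkU ![x, 1, w + 1 + x ^ 3] (DD_aff h)

def xv (v : Fin 3 → ℂ) : ℂ := v 0 / v 1
def wv (v : Fin 3 → ℂ) : ℂ := f3 v / v 1 ^ 3

theorem xv_smul (c : ℂ) (hc : c ≠ 0) (v) : xv (c • v) = xv v := by
  simp only [xv, Pi.smul_apply, smul_eq_mul]; rw [mul_div_mul_left _ _ hc]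
theorem wv_smul (c : ℂ) (hc : c ≠ 0) (v) : wv (c • v) = wv v := by
  simp only [wv, f3_smul, Pi.smul_apply, smul_eq_mul, mul_pow]
  rw [mul_div_mul_left _ _ (pow_ne_zero _ hc)]

theorem aff_rep {x w : ℂ} (h : x ^ 3 + w ^ 2 ≠ 0) : rep (aff x w h) 1 ≠ 0 := by
  obtain ⟨c, hc, h'⟩ := rep_mkU _ (DD_aff h)
  unfold aff
  rw [h']; simpa using hc

theorem xv_aff {x w : ℂ} (h : x ^ 3 + w ^ 2 ≠ 0) : xv (rep (aff x w h)) = x := by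
  obtain ⟨c, hc, h'⟩ := rep_mkU _ (DD_aff h)
  unfold aff
  rw [h', xv_smul c hc]; simp [xv]

theorem wv_aff {x w : ℂ} (h : x ^ 3 + w ^ 2 ≠ 0) : wv (rep (aff x w h)) = w := by
  obtain ⟨c, hc, h'⟩ := rep_mkU _ (DD_aff h)
  unfold aff
  rw [h', wv_smul c hc]; simp [wv, f3]; ring

theorem xw_ne (p : UU) (h : rep p 1 ≠ 0) : xv (rep p) ^ 3 + wv (rep p) ^ 2 ≠ 0 := by
  have h1 : DD (rep p) ≠ 0 := p.2
  have : xv (rep p) ^ 3 + wv (rep p) ^ 2 = DD (rep p) / rep p 1 ^ 6 := by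
    simp only [xv, wv, DD, f2]; field_simp
  rw [this]; exact div_ne_zero h1 (pow_ne_zero _ h)

theorem aff_eq (p : UU) (h : rep p 1 ≠ 0) : aff (xv (rep p)) (wv (rep p)) (xw_ne p h) = p := by
  conv_rhs => rw [← mkU_rep p]
  apply mkU_eq _ _ (rep p 1)⁻¹
  ext i
  fin_cases i
  · simp [xv]; field_simp
  · simp [h]
  · simp [xv, wv, f3]; field_simp; ring

theorem aff_congr {x w x' w' : ℂ} (h : x ^ 3 + w ^ 2 ≠ 0) (h' : x' ^ 3 + w' ^ 2 ≠ 0)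
    (hx : x = x') (hw : w = w') : aff x w h = aff x' w' h' := by subst hx hw; rfl

theorem contAt_xv (v : Fin 3 → ℂ) (h : v 1 ≠ 0) : ContinuousAt xv v := by
  unfold xv; exact ContinuousAt.div (continuous_apply 0).continuousAt
    (continuous_apply 1).continuousAt h
theorem contAt_wv (v : Fin 3 → ℂ) (h : v 1 ≠ 0) : ContinuousAt wv v := by
  unfold wv; exact ContinuousAt.div (by fun_prop)
    ((continuous_apply 1).pow 3).continuousAt (pow_ne_zero _ h)

theorem contAt_xr (p : UU) (h : rep p 1 ≠ 0) : ContinuousAt (fun q : UU => xv (rep q)) p :=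
  contAt_rep xv xv_smul p (contAt_xv _ h)
theorem contAt_wr (p : UU) (h : rep p 1 ≠ 0) : ContinuousAt (fun q : UU => wv (rep q)) p :=
  contAt_rep wv wv_smul p (contAt_wv _ h)

theorem isOpen_y : IsOpen {p : UU | rep p 1 ≠ 0} :=
  isOpen_rep (fun v => v 1 ≠ 0) (fun c hc v hv => by simpa using ⟨hc, hv⟩) (fun v hv =>
    (continuous_apply 1).continuousAt.eventually_ne hv)

theorem isOpen_x : IsOpen {p : UU | rep p 0 ≠ 0} :=
  isOpen_rep (fun v => v 0 ≠ 0) (fun c hc v hv => by simpa using ⟨hc, hv⟩) (fun v hv =>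
    (continuous_apply 0).continuousAt.eventually_ne hv)

theorem cont_aff {S : Type*} [TopologicalSpace S] (f g : S → ℂ) (hf : Continuous f)
    (hg : Continuous g) (hD : ∀ s, f s ^ 3 + g s ^ 2 ≠ 0) :
    Continuous fun s => aff (f s) (g s) (hD s) := by
  apply cont_mkU
  refine continuous_pi ?_
  intro i
  fin_cases i
  · exact hf
  · exact continuous_const
  · exact (hg.add continuous_const).add (hf.pow 3)

end Top

section Models
open Complex (exp log slitPlane)

theorem one_add_slit {e : ℂ} (h : e ∈ slitPlane) : 1 + e ∈ slitPlane := by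
  rw [Complex.mem_slitPlane_iff] at *
  rcases h with h | h
  · left; simp; linarith
  · right; simpa using h

theorem exp_slit {z : ℂ} (h : |z.im| < Real.pi) : exp z ∈ slitPlane := by
  rw [abs_lt] at h
  rw [Complex.mem_slitPlane_iff_arg]
  refine ⟨?_, Complex.exp_ne_zero _⟩
  rw [← Complex.log_im, Complex.log_exp h.1 h.2.le]
  exact h.2.ne

theorem slit_of_both {e : ℂ} (h0 : e ≠ 0) (h1 : 1 + e ∈ slitPlane) (h2 : 1 + e⁻¹ ∈ slitPlane) :
    e ∈ slitPlane := by
  rw [Complex.mem_slitPlane_iff] at *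
  by_contra hc
  push Not at hc
  obtain ⟨hr, hi⟩ := hc
  have he : e = (e.re : ℂ) := by apply Complex.ext <;> simp [hi]
  have hr' : e.re ≠ 0 := by intro h; rw [h] at he; exact h0 (by simpa using he)
  have hneg : e.re < 0 := lt_of_le_of_ne hr hr'
  rw [he] at h1 h2
  rw [← Complex.ofReal_inv] at h2
  simp at h1 h2
  have : e.re * (1 + e.re⁻¹) < 0 := mul_neg_of_neg_of_pos hneg h2
  rw [mul_add, mul_inv_cancel₀ hr'] at this
  linarith

theorem slit_or {u : ℂ} (h1 : 1 + u ≠ 0) : 1 + u ∈ slitPlane ∨ 1 + u⁻¹ ∈ slitPlane := by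
  by_contra hc
  push Not at hc
  obtain ⟨ha, hb⟩ := hc
  rw [Complex.mem_slitPlane_iff] at ha hb
  push Not at ha hb
  obtain ⟨hr, hi⟩ := ha
  have hi : u.im = 0 := by simpa using hi
  have he : u = (u.re : ℂ) := by apply Complex.ext <;> simp [hi]
  have hr' : 1 + u.re ≠ 0 := by
    intro h
    apply h1
    rw [he]; exact_mod_cast h
  have h3 : 1 + u.re < 0 := lt_of_le_of_ne (by simpa using hr) hr'
  have h4 := hb.1
  rw [he, ← Complex.ofReal_inv] at h4
  simp at h4
  have h5 : u.re < 0 := by linarith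
  have : 0 ≤ u.re * (1 + u.re⁻¹) := mul_nonneg_of_nonpos_of_nonpos h5.le h4
  rw [mul_add, mul_inv_cancel₀ h5.ne] at this
  linarith

def omg : ℂ := exp (2 * Real.pi * Complex.I / 3)

theorem omg3 : omg ^ 3 = 1 := by
  rw [omg, ← Complex.exp_nat_mul, ← Complex.exp_two_pi_mul_I]
  congr 1; push_cast; ring

theorem exp_pi3 : exp (Real.pi * Complex.I / 3) ^ 3 = -1 := by
  rw [← Complex.exp_nat_mul, ← Complex.exp_pi_mul_I]
  congr 1; push_cast; ring

/-! ### Model A -/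
abbrev SA : Type := {s : ℂ × ℂ // 1 + s.2 ^ 2 ∈ slitPlane}
abbrev SB : Type := {s : ℂ × ℂ // 1 + s.2 ^ 3 ∈ slitPlane}
abbrev SN : Type := {s : ℂ × ℂ // ‖s.1‖ < 1 / 2 ∧ ‖s.1‖ ^ 2 * ‖s.2‖ < 1 / 2}

theorem slit_scale {e : ℂ} (h : 1 + e ∈ slitPlane) {r : ℝ} (h0 : 0 ≤ r) (h1 : r ≤ 1) :
    1 + r * e ∈ slitPlane := by
  have := Complex.starConvex_one_slitPlane h (a := 1 - r) (b := r) (by linarith) h0 (by ring)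
  convert this using 1
  simp only [Complex.real_smul]
  push_cast; ring

theorem simply_of_scale (P : ℂ × ℂ → Prop) (h0 : P 0)
    (h : ∀ s, P s → ∀ r : ℝ, 0 ≤ r → r ≤ 1 → P (r • s)) : SimplyConnectedSpace {s // P s} := by
  have hs : StarConvex ℝ (0 : ℂ × ℂ) {s | P s} := by
    intro s hs a b ha hb hab
    rw [smul_zero, zero_add]
    exact h s hs b hb (by linarith)
  have : ContractibleSpace {s // P s} := hs.contractibleSpace ⟨0, h0⟩
  infer_instance

instance : SimplyConnectedSpace SA := by
  apply simply_of_scale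
  · simp
  · intro s hs r h0 h1
    have := slit_scale hs (r := r ^ 2) (by positivity) (pow_le_one₀ h0 h1)
    simpa [mul_pow] using this

instance : SimplyConnectedSpace SB := by
  apply simply_of_scale
  · simp
  · intro s hs r h0 h1
    have := slit_scale hs (r := r ^ 3) (by positivity) (pow_le_one₀ h0 h1)
    simpa [mul_pow] using this

instance : SimplyConnectedSpace SN := by
  apply simply_of_scale
  · simp
  · rintro s ⟨hs, hs'⟩ r h0 h1
    simp only [Prod.smul_fst, Prod.smul_snd, norm_smul, Real.norm_eq_abs, abs_of_nonneg h0]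
    refine ⟨lt_of_le_of_lt (mul_le_of_le_one_left (norm_nonneg _) h1) hs, ?_⟩
    have : (r * ‖s.1‖) ^ 2 * (r * ‖s.2‖) = r ^ 3 * (‖s.1‖ ^ 2 * ‖s.2‖) := by ring
    rw [this]
    exact lt_of_le_of_lt (mul_le_of_le_one_left (by positivity) (pow_le_one₀ h0 h1)) hs'

theorem mA_ne (ξ η : ℂ) (h : 1 + η ^ 2 ∈ slitPlane) :
    exp (2 * ξ) ^ 3 + (η * exp (3 * ξ)) ^ 2 ≠ 0 := by
  have : exp (2 * ξ) ^ 3 + (η * exp (3 * ξ)) ^ 2 = exp (6 * ξ) * (1 + η ^ 2) := by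
    rw [mul_pow, ← Complex.exp_nat_mul, ← Complex.exp_nat_mul]; push_cast; ring_nf
  rw [this]
  exact mul_ne_zero (Complex.exp_ne_zero _) (Complex.slitPlane_ne_zero h)

theorem mB_ne (ξ η : ℂ) (h : 1 + η ^ 3 ∈ slitPlane) :
    (η * exp (2 * ξ)) ^ 3 + (exp (3 * ξ)) ^ 2 ≠ 0 := by
  have : (η * exp (2 * ξ)) ^ 3 + (exp (3 * ξ)) ^ 2 = exp (6 * ξ) * (1 + η ^ 3) := by
    rw [mul_pow, ← Complex.exp_nat_mul, ← Complex.exp_nat_mul]; push_cast; ring_nf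
  rw [this]
  exact mul_ne_zero (Complex.exp_ne_zero _) (Complex.slitPlane_ne_zero h)

def mA : C(SA, UU) :=
  ⟨fun s => aff (exp (2 * s.1.1)) (s.1.2 * exp (3 * s.1.1)) (mA_ne _ _ s.2),
    cont_aff _ _ (by fun_prop) (by fun_prop) _⟩

def mB : C(SB, UU) :=
  ⟨fun s => aff (s.1.2 * exp (2 * s.1.1)) (exp (3 * s.1.1)) (mB_ne _ _ s.2),
    cont_aff _ _ (by fun_prop) (by fun_prop) _⟩

theorem mN_ne (y z : ℂ) (h : ‖y‖ < 1 / 2) (h' : ‖y‖ ^ 2 * ‖z‖ < 1 / 2) :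
    DD ![1, y, z + y] ≠ 0 := by
  have h1 : DD ![1, y, z + y] = y ^ 3 + (1 - y ^ 2 * z) ^ 2 := by
    simp [DD, f2, f3]; ring
  rw [h1]
  intro h0
  have h2 : ‖y ^ 3‖ = ‖1 - y ^ 2 * z‖ ^ 2 := by
    rw [← norm_pow, eq_neg_of_add_eq_zero_left h0, norm_neg]
  have h3 : 1 / 2 < ‖1 - y ^ 2 * z‖ := by
    have := norm_sub_norm_le 1 (y ^ 2 * z)
    rw [norm_one, norm_mul, norm_pow] at this
    linarith
  rw [norm_pow] at h2
  have h4 : ‖y‖ ^ 3 ≤ (1 / 2) ^ 3 := pow_le_pow_left₀ (norm_nonneg _) h.le 3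
  nlinarith

def mN : C(SN, UU) :=
  ⟨fun s => mkU ![1, s.1.1, s.1.2 + s.1.1] (mN_ne _ _ s.2.1 s.2.2),
    cont_mkU _ (by
      refine continuous_pi ?_
      intro i
      fin_cases i
      · exact continuous_const
      · exact (continuous_fst.comp continuous_subtype_val)
      · exact (continuous_snd.comp continuous_subtype_val).add
          (continuous_fst.comp continuous_subtype_val)) _⟩

theorem mA_apply (s : SA) : mA s = aff (exp (2 * s.1.1)) (s.1.2 * exp (3 * s.1.1))
    (mA_ne _ _ s.2) := rfl
theorem mB_apply (s : SB) : mB s = aff (s.1.2 * exp (2 * s.1.1)) (exp (3 * s.1.1))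
    (mB_ne _ _ s.2) := rfl

theorem mA_xv (s : SA) : xv (rep (mA s)) = exp (2 * s.1.1) := xv_aff (mA_ne _ _ s.2)
theorem mA_wv (s : SA) : wv (rep (mA s)) = s.1.2 * exp (3 * s.1.1) := wv_aff (mA_ne _ _ s.2)
theorem mB_xv (s : SB) : xv (rep (mB s)) = s.1.2 * exp (2 * s.1.1) := xv_aff (mB_ne _ _ s.2)
theorem mB_wv (s : SB) : wv (rep (mB s)) = exp (3 * s.1.1) := wv_aff (mB_ne _ _ s.2)
theorem mA_y (s : SA) : rep (mA s) 1 ≠ 0 := aff_rep (mA_ne _ _ s.2)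
theorem mB_y (s : SB) : rep (mB s) 1 ≠ 0 := aff_rep (mB_ne _ _ s.2)

theorem eq_of_xw {p q : UU} (hp : rep p 1 ≠ 0) (hq : rep q 1 ≠ 0)
    (hx : xv (rep p) = xv (rep q)) (hw : wv (rep p) = wv (rep q)) : p = q := by
  rw [← aff_eq p hp, ← aff_eq q hq]
  exact aff_congr _ _ hx hw

def thA (s : SA) : SA := ⟨(s.1.1 + Real.pi * Complex.I, - s.1.2), by simpa using s.2⟩
def thB (s : SB) : SB := ⟨(s.1.1 + 2 * Real.pi * Complex.I / 3, omg * s.1.2), by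
  have := s.2
  simpa [mul_pow, omg3] using this⟩

theorem cont_thA : Continuous thA := by unfold thA; fun_prop
theorem cont_thB : Continuous thB := by unfold thB; fun_prop

theorem mA_thA (s : SA) : mA (thA s) = mA s := by
  apply eq_of_xw (mA_y _) (mA_y _)
  · rw [mA_xv, mA_xv, thA]
    rw [Complex.exp_eq_exp_iff_exists_int]
    exact ⟨1, by push_cast; ring⟩
  · rw [mA_wv, mA_wv, thA]
    have : exp (3 * (s.1.1 + Real.pi * Complex.I)) = - exp (3 * s.1.1) := by
      have : 3 * (s.1.1 + Real.pi * Complex.I) = 3 * s.1.1 + 2 * Real.pi * Complex.I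
        + Real.pi * Complex.I := by ring
      rw [this, Complex.exp_add, Complex.exp_pi_mul_I, Complex.exp_add, Complex.exp_two_pi_mul_I]
      ring
    simp only [this]; ring

theorem mB_thB (s : SB) : mB (thB s) = mB s := by
  apply eq_of_xw (mB_y _) (mB_y _)
  · rw [mB_xv, mB_xv, thB]
    have : exp (2 * (s.1.1 + 2 * Real.pi * Complex.I / 3)) = exp (2 * s.1.1) * omg ^ 2 := by
      rw [omg, ← Complex.exp_nat_mul, ← Complex.exp_add]
      congr 1; push_cast; ring
    simp only [this]
    linear_combination (s.1.2 * exp (2 * s.1.1)) * omg3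
  · rw [mB_wv, mB_wv, thB]
    rw [Complex.exp_eq_exp_iff_exists_int]
    exact ⟨1, by push_cast; ring⟩

theorem two_slit : (1 : ℂ) + 1 ∈ slitPlane := one_add_slit Complex.one_mem_slitPlane

def sA0 : SA := ⟨(0, 1), by simpa using two_slit⟩
def sB0 : SB := ⟨(0, 1), by simpa using two_slit⟩
def oo : UU := mA sA0

theorem mA0 : mA sA0 = oo := rfl
theorem mB0 : mB sB0 = oo := by
  apply eq_of_xw (mB_y _) (mA_y _)
  · rw [mB_xv, mA_xv]; simp [sA0, sB0]
  · rw [mB_wv, mA_wv]; simp [sA0, sB0]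

def alp : Path.Homotopic.Quotient oo oo := PP mA sA0 (thA sA0) mA0 ((mA_thA _).trans mA0)
def bet : Path.Homotopic.Quotient oo oo := PP mB sB0 (thB sB0) mB0 ((mB_thB _).trans mB0)

theorem PP_thA (s : SA) {p : UU} (hp : mA s = p) (hp' : mA (thA s) = p) :
    PP mA sA0 (thA s) mA0 hp' = alp.trans (PP mA sA0 s mA0 hp) := by
  rw [← PP_deck thA cont_thA mA_thA sA0 s mA0 hp ((mA_thA _).trans mA0) hp']
  exact (PP_trans _ _ _).symm

theorem PP_thB (s : SB) {p : UU} (hp : mB s = p) (hp' : mB (thB s) = p) :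
    PP mB sB0 (thB s) mB0 hp' = bet.trans (PP mB sB0 s mB0 hp) := by
  rw [← PP_deck thB cont_thB mB_thB sB0 s mB0 hp ((mB_thB _).trans mB0) hp']
  exact (PP_trans _ _ _).symm

/-! ### Overlap of A and B -/
abbrev KK : Type := {k : ℂ × ℂ // |k.2.im| < Real.pi / 2}

instance : PathConnectedSpace KK := by
  have : Convex ℝ {k : ℂ × ℂ | |k.2.im| < Real.pi / 2} := by
    have h : {k : ℂ × ℂ | |k.2.im| < Real.pi / 2} =
        (Complex.imLm ∘ₗ LinearMap.snd ℝ ℂ ℂ) ⁻¹' (Ioo (-(Real.pi / 2)) (Real.pi / 2)) := by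
      ext k
      simp only [mem_ofPred_eq, mem_preimage, mem_Ioo, abs_lt]
      rfl
    rw [h]
    exact (convex_Ioo _ _).linear_preimage _
  exact isPathConnected_iff_pathConnectedSpace.1
    (this.isPathConnected ⟨0, by simp [Real.pi_pos]⟩)

def JA (k : KK) : SA := ⟨(k.1.1, exp k.1.2), by
  rw [← Complex.exp_nat_mul]
  apply one_add_slit (exp_slit _)
  have := k.2
  rw [abs_lt] at this ⊢
  simp
  constructor <;> linarith⟩

def JB (k : KK) : SB := ⟨(k.1.1 + k.1.2 / 3, exp (-2 * k.1.2 / 3)), by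
  rw [← Complex.exp_nat_mul]
  apply one_add_slit (exp_slit _)
  have := k.2
  have h : ((3 : ℕ) : ℂ) * (-2 * k.1.2 / 3) = ((-2 : ℝ) : ℂ) * k.1.2 := by push_cast; ring
  rw [h, Complex.im_ofReal_mul]
  rw [abs_lt] at this ⊢
  constructor <;> linarith⟩

theorem JAB (k : KK) : mA (JA k) = mB (JB k) := by
  apply eq_of_xw (mA_y _) (mB_y _)
  · rw [mA_xv, mB_xv, JA, JB, ← Complex.exp_add]; ring_nf
  · rw [mA_wv, mB_wv, JA, JB, ← Complex.exp_add]; ring_nf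

theorem cont_JA : Continuous JA := by unfold JA; fun_prop
theorem cont_JB : Continuous JB := by unfold JB; fun_prop

def k0 : KK := ⟨(0, 0), by simp [Real.pi_pos]⟩
theorem JA0 : JA k0 = sA0 := by simp [JA, k0, sA0]
theorem JB0 : JB k0 = sB0 := by simp [JB, k0, sB0]

theorem PP_AB (k : KK) {s : SA} {s' : SB} {p : UU} (hs : JA k = s) (hs' : JB k = s')
    (hp : mA s = p) (hp' : mB s' = p) :
    PP mA sA0 s mA0 hp = PP mB sB0 s' mB0 hp' := by
  subst hs hs'
  have := PP_congr JA JB cont_JA cont_JB JAB k0 k (p := oo) (q := p) (by rw [JA0]; exact mA0) hp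
    (by rw [JB0]; exact mB0) hp'
  simpa only [JA0, JB0] using this

/-! ### Overlap of N and B -/
abbrev KN : Type := {k : ℂ × ℂ // Real.log 2 < k.1.re ∧ ‖k.2‖ < 1 / 2}

instance : PathConnectedSpace KN := by
  have : Convex ℝ {k : ℂ × ℂ | Real.log 2 < k.1.re ∧ ‖k.2‖ < 1 / 2} := by
    have h : {k : ℂ × ℂ | Real.log 2 < k.1.re ∧ ‖k.2‖ < 1 / 2} =
        {z : ℂ | Real.log 2 < z.re} ×ˢ Metric.ball (0 : ℂ) (1 / 2) := by
      ext k
      simp only [mem_ofPred_eq, mem_prod, mem_ball_zero_iff]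
    rw [h]
    exact (convex_halfSpace_re_gt _).prod (convex_ball _ _)
  exact isPathConnected_iff_pathConnectedSpace.1
    (this.isPathConnected ⟨(1, 0), by
      have := Real.log_two_lt_d9
      refine ⟨?_, by simp⟩
      simp only [Complex.one_re]
      linarith⟩)

theorem exp_lt_half {r : ℝ} (h : Real.log 2 < r) : Real.exp (-r) < 1 / 2 := by
  rw [one_div, ← Real.exp_log (show (0 : ℝ) < 2⁻¹ by norm_num), Real.exp_lt_exp, Real.log_inv]
  linarith

theorem log_half {r : ℝ} (h0 : 0 < r) (h : r < 1 / 2) : Real.log 2 < - Real.log r := by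
  have := Real.log_lt_log h0 h
  rw [one_div, Real.log_inv] at this
  linarith

def JN (k : KN) : SN := ⟨(exp (-k.1.1), exp (2 * k.1.1) * k.1.2), by
  obtain ⟨h1, h2⟩ := k.2
  have h3 : Real.exp (-k.1.1.re) < 1 / 2 := exp_lt_half h1
  refine ⟨by simpa [Complex.norm_exp] using h3, ?_⟩
  have h4 : ‖exp (-k.1.1)‖ ^ 2 * ‖exp (2 * k.1.1) * k.1.2‖ = ‖k.1.2‖ := by
    rw [norm_mul, ← mul_assoc, ← norm_pow, ← norm_mul, ← Complex.exp_nat_mul, ← Complex.exp_add]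
    have : ((2 : ℕ) : ℂ) * -k.1.1 + 2 * k.1.1 = 0 := by push_cast; ring
    rw [this]; simp
  rw [h4]; exact h2⟩

theorem cont_JN : Continuous JN := by unfold JN; fun_prop

theorem one_sub_slit (k : KN) : 1 - k.1.2 ∈ slitPlane := by
  rw [sub_eq_add_neg]
  apply Complex.mem_slitPlane_of_norm_lt_one
  rw [norm_neg]
  linarith [k.2.2]

def xiN (κ : ℂ) (k : KN) : ℂ := k.1.1 + κ + log (1 - k.1.2) / 3

theorem exp_xiN (κ : ℂ) (hκ : exp κ ^ 3 = -1) (k : KN) :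
    exp (xiN κ k) ^ 3 = - (exp k.1.1 ^ 3 * (1 - k.1.2)) := by
  have h : exp (log (1 - k.1.2) / 3) ^ 3 = 1 - k.1.2 := by
    rw [← Complex.exp_nat_mul]
    push_cast
    rw [mul_div_cancel₀ _ (by norm_num), Complex.exp_log (Complex.slitPlane_ne_zero (one_sub_slit k))]
  rw [xiN, Complex.exp_add, Complex.exp_add, mul_pow, mul_pow, hκ, h]
  ring

def JNB (κ : ℂ) (hκ : exp κ ^ 3 = -1) (k : KN) : SB :=
  ⟨(xiN κ k, exp k.1.1 / exp (xiN κ k) ^ 2), by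
    obtain ⟨h1, h2⟩ := k.2
    apply Complex.mem_slitPlane_of_norm_lt_one
    have h3 : 2 < ‖exp k.1.1‖ := by
      rw [Complex.norm_exp, ← Real.log_lt_iff_lt_exp (by norm_num)]; exact h1
    have h4 : 1 / 2 < ‖1 - k.1.2‖ := by
      have := norm_sub_norm_le 1 (k.1.2)
      rw [norm_one] at this
      linarith
    have h5 : (exp k.1.1 / exp (xiN κ k) ^ 2) ^ 3 = 1 / (exp k.1.1 ^ 3 * (1 - k.1.2) ^ 2) := by
      have : (exp k.1.1 / exp (xiN κ k) ^ 2) ^ 3 = exp k.1.1 ^ 3 / (exp (xiN κ k) ^ 3) ^ 2 := by ring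
      rw [this, exp_xiN κ hκ]
      have := Complex.exp_ne_zero k.1.1
      have := Complex.slitPlane_ne_zero (one_sub_slit k)
      field_simp
    show ‖(exp k.1.1 / exp (xiN κ k) ^ 2) ^ 3‖ < 1
    rw [h5, norm_div, norm_mul, norm_pow, norm_pow, norm_one, div_lt_one (by positivity)]
    have h6 : (2 : ℝ) ^ 3 ≤ ‖exp k.1.1‖ ^ 3 := pow_le_pow_left₀ (by norm_num) h3.le 3
    have h7 : (1 / 2 : ℝ) ^ 2 ≤ ‖1 - k.1.2‖ ^ 2 := pow_le_pow_left₀ (by norm_num) h4.le 2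
    have := mul_le_mul h6 h7 (by norm_num) (by positivity)
    norm_num at this ⊢
    linarith⟩

theorem cont_xiN (κ : ℂ) : Continuous (xiN κ) := by
  unfold xiN
  have : Continuous fun k : KN => log (1 - k.1.2) :=
    Continuous.clog (by fun_prop) one_sub_slit
  fun_prop

theorem cont_JNB (κ : ℂ) (hκ : exp κ ^ 3 = -1) : Continuous (JNB κ hκ) := by
  unfold JNB
  have h1 := cont_xiN κ
  have h2 : Continuous fun k : KN => exp k.1.1 / exp (xiN κ k) ^ 2 :=
    Continuous.div (by fun_prop) (by fun_prop) (fun k => pow_ne_zero _ (Complex.exp_ne_zero _))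
  fun_prop

theorem mN_rep (s : SN) : ∃ c : ℂ, c ≠ 0 ∧ rep (mN s) = c • ![1, s.1.1, s.1.2 + s.1.1] :=
  rep_mkU _ (mN_ne _ _ s.2.1 s.2.2)

theorem mN_y (s : SN) : rep (mN s) 1 ≠ 0 ↔ s.1.1 ≠ 0 := by
  obtain ⟨c, hc, h⟩ := mN_rep s
  rw [h]; simp [hc]

theorem mN_xv (s : SN) : xv (rep (mN s)) = 1 / s.1.1 := by
  obtain ⟨c, hc, h⟩ := mN_rep s
  rw [h, xv_smul _ hc]; simp [xv]

theorem mN_wv (s : SN) :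
    wv (rep (mN s)) = (s.1.1 ^ 2 * s.1.2 - 1) / s.1.1 ^ 3 := by
  obtain ⟨c, hc, h⟩ := mN_rep s
  rw [h, wv_smul _ hc]; simp [wv, f3]; ring

theorem JN_y (k : KN) : (JN k).1.1 ≠ 0 := Complex.exp_ne_zero _

theorem exp3 (z : ℂ) : exp (3 * z) = exp z ^ 3 := by
  rw [← Complex.exp_nat_mul]; rfl
theorem exp2 (z : ℂ) : exp (2 * z) = exp z ^ 2 := by
  rw [← Complex.exp_nat_mul]; rfl

theorem JNNB (κ : ℂ) (hκ : exp κ ^ 3 = -1) (k : KN) : mN (JN k) = mB (JNB κ hκ k) := by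
  have h1 := Complex.exp_ne_zero k.1.1
  have h2 := Complex.exp_ne_zero (xiN κ k)
  apply eq_of_xw ((mN_y _).2 (JN_y _)) (mB_y _)
  · rw [mN_xv, mB_xv]
    simp only [JN, JNB, Complex.exp_neg, exp2]
    field_simp
  · rw [mN_wv, mB_wv]
    simp only [JN, JNB, Complex.exp_neg, exp2, exp3, exp_xiN κ hκ]
    field_simp
    ring

/-- recover `k` from a point of `SN` with nonzero first coordinate -/
def kOf (n : SN) (hn : n.1.1 ≠ 0) : KN := ⟨(-log n.1.1, n.1.1 ^ 2 * n.1.2), by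
  obtain ⟨h1, h2⟩ := n.2
  refine ⟨?_, by simpa using h2⟩
  rw [Complex.neg_re, Complex.log_re]
  exact log_half (norm_pos_iff.2 hn) h1⟩

theorem JN_kOf (n : SN) (hn : n.1.1 ≠ 0) : JN (kOf n hn) = n := by
  apply Subtype.ext
  apply Prod.ext
  · simp [JN, kOf, Complex.exp_log hn]
  · simp only [JN, kOf]
    rw [exp2, Complex.exp_neg, Complex.exp_log hn]
    field_simp

/-! ### The relations -/
theorem bet3 : bet.trans (bet.trans bet) = .refl oo := by
  have e1 : PP mB sB0 (thB (thB (thB sB0))) mB0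
      ((mB_thB _).trans ((mB_thB _).trans ((mB_thB _).trans mB0))) = bet.trans (bet.trans bet) := by
    rw [PP_thB _ ((mB_thB _).trans ((mB_thB _).trans mB0)), PP_thB _ ((mB_thB _).trans mB0)]
    rfl
  rw [← e1]
  have hl : Real.log 2 < 1 := by linarith [Real.log_two_lt_d9]
  let ka : KN := ⟨(1, 0), by simpa using hl⟩
  let kb : KN := ⟨(1 + 2 * Real.pi * Complex.I, 0), by simpa using hl⟩
  let κ : ℂ := Real.pi * Complex.I / 3
  have hκ : exp κ ^ 3 = -1 := exp_pi3
  have hJ : JN kb = JN ka := by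
    apply Subtype.ext
    apply Prod.ext
    · simp only [JN, ka, kb]
      rw [Complex.exp_eq_exp_iff_exists_int]
      exact ⟨-1, by push_cast; ring⟩
    · simp [JN, ka, kb]
  have hθ : JNB κ hκ kb = thB (thB (thB (JNB κ hκ ka))) := by
    have e : exp (xiN κ kb) = exp (xiN κ ka) := by
      rw [Complex.exp_eq_exp_iff_exists_int]
      exact ⟨1, by simp only [xiN, ka, kb]; push_cast; ring⟩
    have e' : exp kb.1.1 = exp ka.1.1 := by
      rw [Complex.exp_eq_exp_iff_exists_int]
      exact ⟨1, by simp only [ka, kb]; push_cast; ring⟩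
    apply Subtype.ext
    apply Prod.ext
    · simp only [JNB, thB, xiN, ka, kb]; ring
    · simp only [JNB, thB]
      rw [e, e']
      linear_combination (-exp ka.1.1 / exp (xiN κ ka) ^ 2) * omg3
  have hb : mB (JNB κ hκ kb) = mB (JNB κ hκ ka) := by rw [← JNNB, ← JNNB, hJ]
  have h1 : PP mB (JNB κ hκ ka) (JNB κ hκ kb) rfl hb = .refl _ := by
    rw [← PP_congr JN (JNB κ hκ) cont_JN (cont_JNB κ hκ) (JNNB κ hκ) ka kb (JNNB κ hκ ka)
      ((JNNB κ hκ kb).trans hb) rfl hb]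
    have : ∀ (n : SN) (hn : n = JN ka) (hq : mN n = mB (JNB κ hκ ka)),
        PP mN (JN ka) n (JNNB κ hκ ka) hq = .refl _ := by
      intro n hn hq
      subst hn
      exact PP_self _ _
    exact this _ hJ _
  have h2 := PP_deck (m := mB) (fun s => thB (thB (thB s)))
    (cont_thB.comp (cont_thB.comp cont_thB))
    (fun s => (mB_thB _).trans ((mB_thB _).trans (mB_thB s))) (JNB κ hκ ka) sB0 rfl mB0
    (by rw [← hθ]; exact hb) ((mB_thB _).trans ((mB_thB _).trans ((mB_thB _).trans mB0)))
  simp only [← hθ] at h2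
  rw [← PP_trans mB0 (hb) ((mB_thB _).trans ((mB_thB _).trans ((mB_thB _).trans mB0))), h2,
    ← PP_trans mB0 rfl hb, h1, Path.Homotopic.Quotient.trans_refl, PP_trans]
  exact PP_self _ _

theorem alp2 : alp.trans alp = .refl oo := by
  have e1 : PP mA sA0 (thA (thA sA0)) mA0 ((mA_thA _).trans ((mA_thA _).trans mA0))
      = alp.trans alp := by
    rw [PP_thA _ ((mA_thA _).trans mA0)]
    rfl
  rw [← e1, ← bet3]
  have e1 : PP mB sB0 (thB (thB (thB sB0))) mB0
      ((mB_thB _).trans ((mB_thB _).trans ((mB_thB _).trans mB0))) = bet.trans (bet.trans bet) := by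
    rw [PP_thB _ ((mB_thB _).trans ((mB_thB _).trans mB0)), PP_thB _ ((mB_thB _).trans mB0)]
    rfl
  rw [← e1]
  let k : KK := ⟨(2 * Real.pi * Complex.I, 0), by simp [Real.pi_pos]⟩
  apply PP_AB k
  · apply Subtype.ext
    apply Prod.ext
    · simp only [JA, k, thA, sA0]; ring
    · simp [JA, k, thA, sA0]
  · apply Subtype.ext
    apply Prod.ext
    · simp only [JB, k, thB, sB0]; ring
    · simp only [JB, k, thB, sB0]
      simp only [mul_zero, zero_div, Complex.exp_zero]
      linear_combination - omg3

end Models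

section Gener
open Complex (exp log slitPlane)

def regA (p : UU) : Prop := rep p 1 ≠ 0 ∧ xv (rep p) ≠ 0 ∧
  1 + wv (rep p) ^ 2 / xv (rep p) ^ 3 ∈ slitPlane
def regB (p : UU) : Prop := rep p 1 ≠ 0 ∧ wv (rep p) ≠ 0 ∧
  1 + xv (rep p) ^ 3 / wv (rep p) ^ 2 ∈ slitPlane

theorem mA_u (s : SA) : wv (rep (mA s)) ^ 2 / xv (rep (mA s)) ^ 3 = s.1.2 ^ 2 := by
  have := Complex.exp_ne_zero s.1.1
  rw [mA_wv, mA_xv, exp2, exp3]; field_simp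
theorem mB_u (s : SB) : xv (rep (mB s)) ^ 3 / wv (rep (mB s)) ^ 2 = s.1.2 ^ 3 := by
  have := Complex.exp_ne_zero s.1.1
  rw [mB_wv, mB_xv, exp2, exp3]; field_simp

theorem reg_cover (p : UU) (h : rep p 1 ≠ 0) : regA p ∨ regB p := by
  have h1 := xw_ne p h
  by_cases hx : xv (rep p) = 0
  · right
    refine ⟨h, ?_, ?_⟩
    · intro hw; apply h1; simp [hx, hw]
    · simp [hx]
  by_cases hw : wv (rep p) = 0
  · left
    exact ⟨h, hx, by simp [hw]⟩
  have := slit_or (u := wv (rep p) ^ 2 / xv (rep p) ^ 3) (by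
    intro h0
    apply h1
    field_simp at h0
    simpa using h0)
  rcases this with h2 | h2
  · exact Or.inl ⟨h, hx, h2⟩
  · rw [inv_div] at h2
    exact Or.inr ⟨h, hw, h2⟩

theorem isOpen_regA : IsOpen {p | regA p} := by
  rw [isOpen_iff_mem_nhds]
  rintro p ⟨h1, h2, h3⟩
  filter_upwards [isOpen_y.mem_nhds h1, (contAt_xr p h1).eventually_ne h2,
    (continuousAt_const.add (((contAt_wr p h1).pow 2).div ((contAt_xr p h1).pow 3)
      (pow_ne_zero _ h2))).eventually (Complex.isOpen_slitPlane.mem_nhds h3)] with q a b c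
  exact ⟨a, b, c⟩

theorem isOpen_regB : IsOpen {p | regB p} := by
  rw [isOpen_iff_mem_nhds]
  rintro p ⟨h1, h2, h3⟩
  filter_upwards [isOpen_y.mem_nhds h1, (contAt_wr p h1).eventually_ne h2,
    (continuousAt_const.add (((contAt_xr p h1).pow 3).div ((contAt_wr p h1).pow 2)
      (pow_ne_zero _ h2))).eventually (Complex.isOpen_slitPlane.mem_nhds h3)] with q a b c
  exact ⟨a, b, c⟩

theorem cont_path_xv {a b : UU} (γ : Path a b) (h : ∀ t, rep (γ t) 1 ≠ 0) :
    Continuous fun t => xv (rep (γ t)) :=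
  continuous_iff_continuousAt.2 fun t =>
    (contAt_xr (γ t) (h t)).comp (f := γ) γ.continuous.continuousAt
theorem cont_path_wv {a b : UU} (γ : Path a b) (h : ∀ t, rep (γ t) 1 ≠ 0) :
    Continuous fun t => wv (rep (γ t)) :=
  continuous_iff_continuousAt.2 fun t =>
    (contAt_wr (γ t) (h t)).comp (f := γ) γ.continuous.continuousAt

/-- abstract lifting of a logarithm -/
theorem lift_log (g : I → ℂ) (hg : Continuous g) (c : ℂ) (hc : c ≠ 0)
    (h : ∀ t, g t / c ∈ slitPlane) (n : ℕ) (hn : n ≠ 0) (ξ : ℂ) (h0 : exp (n * ξ) = g 0) :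
    ∃ f : I → ℂ, Continuous f ∧ f 0 = ξ ∧ ∀ t, exp (n * f t) = g t := by
  have hn' : (n : ℂ) ≠ 0 := by exact_mod_cast hn
  refine ⟨fun t => ξ + (log (g t / c) - log (g 0 / c)) / n, ?_, by simp, ?_⟩
  · have : Continuous fun t => log (g t / c) := Continuous.clog (by fun_prop) h
    fun_prop
  · intro t
    have h1 := Complex.slitPlane_ne_zero (h t)
    have h2 := Complex.slitPlane_ne_zero (h 0)
    have h3 : g 0 ≠ 0 := fun h => h2 (by simp [h])
    rw [mul_add, mul_div_cancel₀ _ hn', Complex.exp_add, Complex.exp_sub, Complex.exp_log h1,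
      Complex.exp_log h2, h0]
    field_simp

theorem lift_A {a b : UU} (γ : Path a b) (c : ℂ) (hc : c ≠ 0) (h : ∀ t, regA (γ t))
    (h' : ∀ t, xv (rep (γ t)) / c ∈ slitPlane) (s : SA) (hs : mA s = a) :
    ∃ (s' : SA) (δ : Path s s'), ∀ t, γ t = mA (δ t) := by
  have hx := cont_path_xv γ (fun t => (h t).1)
  have hw := cont_path_wv γ (fun t => (h t).1)
  obtain ⟨f, hf, hf0, hft⟩ := lift_log _ hx c hc h' 2 (by norm_num) s.1.1 (by
    rw [γ.source, ← hs, mA_xv]; rfl)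
  push_cast at hft
  have hne : ∀ t, exp (f t) ≠ 0 := fun t => Complex.exp_ne_zero _
  let η : I → ℂ := fun t => wv (rep (γ t)) / exp (f t) ^ 3
  have hη : Continuous η := hw.div (by fun_prop) (fun t => pow_ne_zero _ (hne t))
  have hmem : ∀ t, 1 + (η t) ^ 2 ∈ slitPlane := by
    intro t
    convert (h t).2.2 using 2
    simp only [η]
    rw [← hft t, exp2]; ring
  let d : I → SA := fun t => ⟨(f t, η t), hmem t⟩
  have hd : Continuous d := by
    apply Continuous.subtype_mk
    exact hf.prodMk hη
  have hd0 : d 0 = s := by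
    apply Subtype.ext
    apply Prod.ext
    · exact hf0
    · simp only [d, η]
      have := hne 0
      rw [γ.source, ← hs, mA_wv, exp3, ← hf0]; field_simp
  refine ⟨d 1, ⟨⟨d, hd⟩, hd0, rfl⟩, ?_⟩
  intro t
  have := hne t
  refine eq_of_xw (h t).1 (mA_y _) ?_ ?_
  · rw [mA_xv]; exact (hft t).symm
  · rw [mA_wv]
    show _ = wv (rep (γ t)) / exp (f t) ^ 3 * exp (3 * f t)
    rw [exp3]; field_simp

theorem lift_B {a b : UU} (γ : Path a b) (c : ℂ) (hc : c ≠ 0) (h : ∀ t, regB (γ t))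
    (h' : ∀ t, wv (rep (γ t)) / c ∈ slitPlane) (s : SB) (hs : mB s = a) :
    ∃ (s' : SB) (δ : Path s s'), ∀ t, γ t = mB (δ t) := by
  have hx := cont_path_xv γ (fun t => (h t).1)
  have hw := cont_path_wv γ (fun t => (h t).1)
  obtain ⟨f, hf, hf0, hft⟩ := lift_log _ hw c hc h' 3 (by norm_num) s.1.1 (by
    rw [γ.source, ← hs, mB_wv]; rfl)
  push_cast at hft
  have hne : ∀ t, exp (f t) ≠ 0 := fun t => Complex.exp_ne_zero _
  let η : I → ℂ := fun t => xv (rep (γ t)) / exp (f t) ^ 2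
  have hη : Continuous η := hx.div (by fun_prop) (fun t => pow_ne_zero _ (hne t))
  have hmem : ∀ t, 1 + (η t) ^ 3 ∈ slitPlane := by
    intro t
    convert (h t).2.2 using 2
    simp only [η]
    rw [← hft t, exp3]; ring
  let d : I → SB := fun t => ⟨(f t, η t), hmem t⟩
  have hd : Continuous d := by
    apply Continuous.subtype_mk
    exact hf.prodMk hη
  have hd0 : d 0 = s := by
    apply Subtype.ext
    apply Prod.ext
    · exact hf0
    · simp only [d, η]
      have := hne 0
      rw [γ.source, ← hs, mB_xv, exp2, ← hf0]; field_simp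
  refine ⟨d 1, ⟨⟨d, hd⟩, hd0, rfl⟩, ?_⟩
  intro t
  have := hne t
  refine eq_of_xw (h t).1 (mB_y _) ?_ ?_
  · rw [mB_xv]
    show _ = xv (rep (γ t)) / exp (f t) ^ 2 * exp (2 * f t)
    rw [exp2]; field_simp
  · rw [mB_wv]; exact (hft t).symm

/-! coordinates near the line `y = 0` -/
def cy (v : Fin 3 → ℂ) : ℂ := v 1 / v 0
def cz (v : Fin 3 → ℂ) : ℂ := (v 2 - v 1) / v 0
theorem cy_smul (c : ℂ) (hc : c ≠ 0) (v) : cy (c • v) = cy v := by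
  simp only [cy, Pi.smul_apply, smul_eq_mul]; rw [mul_div_mul_left _ _ hc]
theorem cz_smul (c : ℂ) (hc : c ≠ 0) (v) : cz (c • v) = cz v := by
  simp only [cz, Pi.smul_apply, smul_eq_mul]; rw [← mul_sub, mul_div_mul_left _ _ hc]

def regN (p : UU) : Prop := rep p 0 ≠ 0 ∧ ‖cy (rep p)‖ < 1 / 2 ∧
  ‖cy (rep p)‖ ^ 2 * ‖cz (rep p)‖ < 1 / 2

theorem contAt_cy (p : UU) (h : rep p 0 ≠ 0) : ContinuousAt (fun q : UU => cy (rep q)) p :=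
  contAt_rep cy cy_smul p (ContinuousAt.div (continuous_apply 1).continuousAt
    (continuous_apply 0).continuousAt h)
theorem contAt_cz (p : UU) (h : rep p 0 ≠ 0) : ContinuousAt (fun q : UU => cz (rep q)) p :=
  contAt_rep cz cz_smul p (ContinuousAt.div
    ((continuous_apply 2).sub (continuous_apply 1)).continuousAt
    (continuous_apply 0).continuousAt h)

theorem isOpen_regN : IsOpen {p | regN p} := by
  rw [isOpen_iff_mem_nhds]
  rintro p ⟨h1, h2, h3⟩
  filter_upwards [isOpen_x.mem_nhds h1, (contAt_cy p h1).norm.eventually_lt_const h2,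
    (((contAt_cy p h1).norm.pow 2).mul (contAt_cz p h1).norm).eventually_lt_const h3] with q a b c
  exact ⟨a, b, c⟩

theorem regN_of (p : UU) (h : rep p 1 = 0) : regN p := by
  refine ⟨?_, by simp [cy, h], by simp [cy, h]⟩
  intro h0
  have : DD (rep p) ≠ 0 := p.2
  simp [DD, f2, f3, h, h0] at this

def nOf (p : UU) (h : regN p) : SN := ⟨(cy (rep p), cz (rep p)), h.2⟩

theorem mN_nOf (p : UU) (h : regN p) : mN (nOf p h) = p := by
  conv_rhs => rw [← mkU_rep p]
  have h0 := h.1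
  apply mkU_eq (mN_ne _ _ h.2.1 h.2.2) _ (rep p 0)⁻¹
  ext i
  fin_cases i
  · simp [h0]
  · simp [nOf, cy]; field_simp
  · simp [nOf, cy, cz]; field_simp; ring

theorem nOf_mN (n : SN) (h : regN (mN n)) : nOf (mN n) h = n := by
  obtain ⟨c, hc, h'⟩ := mN_rep n
  apply Subtype.ext
  apply Prod.ext
  · simp only [nOf]
    rw [h', cy_smul _ hc]; simp [cy]
  · simp only [nOf]
    rw [h', cz_smul _ hc]; simp [cz]

theorem lift_N {a b : UU} (γ : Path a b) (h : ∀ t, regN (γ t)) (s : SN) (hs : mN s = a) :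
    ∃ (s' : SN) (δ : Path s s'), ∀ t, γ t = mN (δ t) := by
  let d : I → SN := fun t => nOf (γ t) (h t)
  have hd : Continuous d := by
    apply Continuous.subtype_mk
    apply Continuous.prodMk
    · exact continuous_iff_continuousAt.2 fun t =>
        (contAt_cy (γ t) (h t).1).comp (f := γ) γ.continuous.continuousAt
    · exact continuous_iff_continuousAt.2 fun t =>
        (contAt_cz (γ t) (h t).1).comp (f := γ) γ.continuous.continuousAt
  have hd0 : d 0 = s := by
    have : ∀ p (hp : p = mN s) (hr : regN p), nOf p hr = s := by
      intro p hp hr; subst hp; exact nOf_mN _ _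
    exact this _ (by rw [γ.source, hs]) _
  exact ⟨d 1, ⟨⟨d, hd⟩, hd0, rfl⟩, fun t => (mN_nOf (γ t) (h t)).symm⟩

/-- near the line `y = 0` but off it we are in region B -/
theorem regB_of_N (n : SN) (hn : n.1.1 ≠ 0) : ∃ s : SB, mB s = mN n := by
  refine ⟨JNB _ exp_pi3 (kOf n hn), ?_⟩
  rw [← JNNB, JN_kOf]

variable (Hs : Path.Homotopic.Quotient oo oo → Prop)

def GA (p : UU) (c : Path.Homotopic.Quotient oo p) : Prop :=
  ∃ h, Hs h ∧ ∃ (s : SA) (hs : mA s = p), c = h.trans (PP mA sA0 s mA0 hs)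
def GB (p : UU) (c : Path.Homotopic.Quotient oo p) : Prop :=
  ∃ h, Hs h ∧ ∃ (s : SB) (hs : mB s = p), c = h.trans (PP mB sB0 s mB0 hs)
def GN (p : UU) (c : Path.Homotopic.Quotient oo p) : Prop :=
  ∃ (q : UU) (c' : Path.Homotopic.Quotient oo q), GB Hs q c' ∧ ∃ (n n' : SN) (hn : mN n = q)
    (hn' : mN n' = p), c = c'.trans (PP mN n n' hn hn')

variable {Hs}

theorem GA_path {a b : UU} (γ : Path a b) (c : ℂ) (hc : c ≠ 0) (h : ∀ t, regA (γ t))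
    (h' : ∀ t, xv (rep (γ t)) / c ∈ slitPlane) (e) (he : GA Hs a e) :
    GA Hs b (e.trans (.mk γ)) := by
  obtain ⟨g, hg, s, hs, rfl⟩ := he
  obtain ⟨s', δ, hδ⟩ := lift_A γ c hc h h' s hs
  have hs' : mA s' = b := by rw [← δ.target, ← hδ, γ.target]
  refine ⟨g, hg, s', hs', ?_⟩
  rw [← PP_eq hs hs' δ γ hδ, Path.Homotopic.Quotient.trans_assoc, PP_trans]

theorem GB_path {a b : UU} (γ : Path a b) (c : ℂ) (hc : c ≠ 0) (h : ∀ t, regB (γ t))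
    (h' : ∀ t, wv (rep (γ t)) / c ∈ slitPlane) (e) (he : GB Hs a e) :
    GB Hs b (e.trans (.mk γ)) := by
  obtain ⟨g, hg, s, hs, rfl⟩ := he
  obtain ⟨s', δ, hδ⟩ := lift_B γ c hc h h' s hs
  have hs' : mB s' = b := by rw [← δ.target, ← hδ, γ.target]
  refine ⟨g, hg, s', hs', ?_⟩
  rw [← PP_eq hs hs' δ γ hδ, Path.Homotopic.Quotient.trans_assoc, PP_trans]

theorem GN_path {a b : UU} (γ : Path a b) (h : ∀ t, regN (γ t)) (e) (he : GN Hs a e) :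
    GN Hs b (e.trans (.mk γ)) := by
  obtain ⟨q, c', hc', n, n', hn, hn', rfl⟩ := he
  obtain ⟨s', δ, hδ⟩ := lift_N γ h n' hn'
  have hs' : mN s' = b := by rw [← δ.target, ← hδ, γ.target]
  refine ⟨q, c', hc', n, s', hn, hs', ?_⟩
  rw [← PP_eq hn' hs' δ γ hδ, Path.Homotopic.Quotient.trans_assoc, PP_trans]

theorem GB_to_GN {p : UU} {c} (h : GB Hs p c) (hp : regN p) : GN Hs p c := by
  refine ⟨p, c, h, nOf p hp, nOf p hp, mN_nOf _ _, mN_nOf _ _, ?_⟩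
  rw [PP_self, Path.Homotopic.Quotient.trans_refl]

theorem GN_to_GB {p : UU} {c} (h : GN Hs p c) (hp : rep p 1 ≠ 0) : GB Hs p c := by
  obtain ⟨q, c', ⟨g, hg, s, hs, rfl⟩, n, n', hn, hn', rfl⟩ := h
  subst hn
  have hy : n.1.1 ≠ 0 := by rw [← mN_y, ← hs]; exact mB_y _
  have hy' : n'.1.1 ≠ 0 := by rw [← mN_y, hn']; exact hp
  let k := kOf n hy
  let k' := kOf n' hy'
  have hk : JN k = n := JN_kOf n hy
  have hk' : JN k' = n' := JN_kOf n' hy'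
  let κ : ℂ := s.1.1 - k.1.1 - log (1 - k.1.2) / 3
  have hξ : xiN κ k = s.1.1 := by simp only [xiN, κ]; ring
  have hne := Complex.exp_ne_zero k.1.1
  have hne2 := Complex.slitPlane_ne_zero (one_sub_slit k)
  have hx : s.1.2 * exp s.1.1 ^ 2 = exp k.1.1 := by
    rw [← exp2, ← mB_xv, hs, ← hk, mN_xv]
    simp [JN, Complex.exp_neg]
  have hw : exp s.1.1 ^ 3 = -(exp k.1.1 ^ 3 * (1 - k.1.2)) := by
    rw [← exp3, ← mB_wv, hs, ← hk, mN_wv]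
    simp only [JN, Complex.exp_neg, exp2]
    field_simp
    ring
  have hκ : exp κ ^ 3 = -1 := by
    simp only [κ]
    rw [Complex.exp_sub, Complex.exp_sub, div_pow, div_pow, hw]
    have : exp (log (1 - k.1.2) / 3) ^ 3 = 1 - k.1.2 := by
      rw [← exp3, mul_div_cancel₀ _ (by norm_num), Complex.exp_log hne2]
    rw [this]
    field_simp
  have hJ : JNB κ hκ k = s := by
    apply Subtype.ext
    apply Prod.ext
    · exact hξ
    · simp only [JNB]
      rw [hξ, ← hx]
      have := Complex.exp_ne_zero s.1.1
      field_simp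
  have hmk : mB (JNB κ hκ k') = p := by rw [← JNNB, hk', hn']
  refine ⟨g, hg, JNB κ hκ k', hmk, ?_⟩
  have := PP_congr JN (JNB κ hκ) cont_JN (cont_JNB κ hκ) (JNNB κ hκ) k k' (p := mN n) (q := p)
    (by rw [hk]) (by rw [hk', hn']) (by rw [hJ, hs]) hmk
  simp only [hk, hk', hJ] at this
  rw [this, Path.Homotopic.Quotient.trans_assoc, PP_trans]

theorem GA_to_GB (hα : ∀ h, Hs h → Hs (h.trans alp.symm)) {p : UU} {c} (h : GA Hs p c) (hp : regB p) : GB Hs p c := by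
  have main : ∀ g, Hs g → ∀ (s : SA) (hs : mA s = p), 0 < s.1.2.re →
      GB Hs p (g.trans (PP mA sA0 s mA0 hs)) := by
    intro g hg s hs hre
    have h0 : s.1.2 ≠ 0 := by intro h; rw [h] at hre; simp at hre
    let k : KK := ⟨(s.1.1, log s.1.2), by
      simp only [Complex.log_im]
      rw [Complex.abs_arg_lt_pi_div_two_iff]
      exact Or.inl hre⟩
    have hk : JA k = s := by
      apply Subtype.ext
      apply Prod.ext
      · rfl
      · simp only [JA, k]; exact Complex.exp_log h0
    have hk' : mB (JB k) = p := by rw [← JAB, hk, hs]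
    exact ⟨g, hg, JB k, hk', by rw [PP_AB k hk rfl hs hk']⟩
  obtain ⟨g, hg, s, hs, rfl⟩ := h
  obtain ⟨h1, h2, h3⟩ := hp
  have h0 : s.1.2 ≠ 0 := by
    intro h
    rw [← hs, mA_wv, h] at h2
    simp at h2
  have h4 : s.1.2 ^ 2 ∈ slitPlane := by
    apply slit_of_both (pow_ne_zero _ h0) s.2
    rw [← mA_u, hs, inv_div]; exact h3
  have h5 : s.1.2.re ≠ 0 := by
    intro h
    rw [Complex.mem_slitPlane_iff, pow_two] at h4
    simp [h] at h4
    nlinarith [mul_self_nonneg s.1.2.im]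
  rcases lt_or_gt_of_ne h5 with h6 | h6
  · have hth : mA (thA s) = p := (mA_thA s).trans hs
    have := main (g.trans alp.symm) (hα g hg) (thA s) hth (by simpa [thA] using h6)
    rw [PP_thA s hs hth, Path.Homotopic.Quotient.trans_assoc,
      ← Path.Homotopic.Quotient.trans_assoc alp.symm, Path.Homotopic.Quotient.symm_trans,
      Path.Homotopic.Quotient.refl_trans] at this
    exact this
  · exact main g hg s hs h6

theorem cube_cases {η μ : ℂ} (h : μ ^ 3 = η ^ 3) :
    μ = η ∨ μ = omg * η ∨ μ = omg * (omg * η) := by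
  have h1 : omg ≠ 1 := by
    intro h
    rw [omg, Complex.exp_eq_one_iff] at h
    obtain ⟨n, hn⟩ := h
    have h3 : (2 * Real.pi * Complex.I : ℂ) ≠ 0 := Complex.two_pi_I_ne_zero
    have h4 : (1 : ℂ) = 3 * n := by
      apply mul_left_cancel₀ h3
      linear_combination 3 * hn
    have h5 : (1 : ℤ) = 3 * n := by exact_mod_cast h4
    omega
  have h2 : omg ^ 2 + omg + 1 = 0 := by
    apply mul_left_cancel₀ (sub_ne_zero.2 h1)
    linear_combination omg3
  have h3 : (μ - η) * ((μ - omg * η) * (μ - omg * (omg * η))) = 0 := by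
    linear_combination h + (-η * μ ^ 2 + η ^ 2 * μ * omg) * h2 - η ^ 3 * omg3
  rcases mul_eq_zero.1 h3 with h | h
  · exact Or.inl (sub_eq_zero.1 h)
  rcases mul_eq_zero.1 h with h | h
  · exact Or.inr (Or.inl (sub_eq_zero.1 h))
  · exact Or.inr (Or.inr (sub_eq_zero.1 h))

theorem GB_to_GA (hβ : ∀ h, Hs h → Hs (h.trans bet.symm)) {p : UU} {c} (h : GB Hs p c) (hp : regA p) : GA Hs p c := by
  have main : ∀ g, Hs g → ∀ (s : SB) (hs : mB s = p), s.1.2 ^ 3 ∈ slitPlane →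
      exp (log (s.1.2 ^ 3) / 3) = s.1.2 →
      GA Hs p (g.trans (PP mB sB0 s mB0 hs)) := by
    intro g hg s hs hsl he
    let l := -(log (s.1.2 ^ 3) / 2)
    let k : KK := ⟨(s.1.1 - l / 3, l), by
      have : l.im = - (Complex.arg (s.1.2 ^ 3)) / 2 := by
        simp only [l]
        rw [Complex.neg_im, Complex.div_ofNat_im, Complex.log_im]; ring
      show |l.im| < _
      rw [this, abs_lt]
      have h1 := Complex.arg_le_pi (s.1.2 ^ 3)
      have h2 := Complex.neg_pi_lt_arg (s.1.2 ^ 3)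
      have h3 := lt_of_le_of_ne h1 (Complex.slitPlane_arg_ne_pi hsl)
      constructor <;> linarith⟩
    have hk : JB k = s := by
      apply Subtype.ext
      apply Prod.ext
      · simp only [JB, k]; ring
      · simp only [JB, k]
        rw [← he]
        congr 1
        simp only [l]
        ring
    have hk' : mA (JA k) = p := by rw [JAB, hk, hs]
    exact ⟨g, hg, JA k, hk', by rw [PP_AB k rfl hk hk' hs]⟩
  have step : ∀ (g : Path.Homotopic.Quotient oo oo) (s : SB) (hs : mB s = p) (hth : mB (thB s) = p),
      g.trans (PP mB sB0 s mB0 hs) =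
      (g.trans bet.symm).trans (PP mB sB0 (thB s) mB0 hth) := by
    intro g s hs hth
    rw [PP_thB s hs hth, Path.Homotopic.Quotient.trans_assoc,
      ← Path.Homotopic.Quotient.trans_assoc bet.symm, Path.Homotopic.Quotient.symm_trans,
      Path.Homotopic.Quotient.refl_trans]
  obtain ⟨g, hg, s, hs, rfl⟩ := h
  obtain ⟨h1, h2, h3⟩ := hp
  have h0 : s.1.2 ≠ 0 := by
    intro h
    rw [← hs, mB_xv, h] at h2
    simp at h2
  have h4 : s.1.2 ^ 3 ∈ slitPlane := by
    apply slit_of_both (pow_ne_zero _ h0) s.2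
    rw [← mB_u, hs, inv_div]; exact h3
  have hμ : exp (log (s.1.2 ^ 3) / 3) ^ 3 = s.1.2 ^ 3 := by
    rw [← exp3, mul_div_cancel₀ _ (by norm_num), Complex.exp_log (pow_ne_zero _ h0)]
  have hth : mB (thB s) = p := (mB_thB s).trans hs
  have hth2 : mB (thB (thB s)) = p := (mB_thB _).trans hth
  have e1 : (thB s).1.2 ^ 3 = s.1.2 ^ 3 := by simp [thB, mul_pow, omg3]
  have e2 : (thB (thB s)).1.2 ^ 3 = s.1.2 ^ 3 := by simp [thB, mul_pow, omg3]
  rcases cube_cases hμ with h | h | h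
  · exact main g hg s hs h4 h
  · rw [step g s hs hth]
    exact main _ (hβ _ hg) _ hth (by rwa [e1]) (by rw [e1]; exact h)
  · rw [step g s hs hth, step _ _ hth hth2]
    exact main _ (hβ _ (hβ _ hg)) _ hth2 (by rwa [e2]) (by rw [e2]; exact h)


theorem alp_symm : alp.symm = alp := by
  rw [← Path.Homotopic.Quotient.trans_refl alp.symm, ← alp2,
    ← Path.Homotopic.Quotient.trans_assoc, Path.Homotopic.Quotient.symm_trans,
    Path.Homotopic.Quotient.refl_trans]

def Good (Hs : Path.Homotopic.Quotient oo oo → Prop) (p : UU)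
    (c : Path.Homotopic.Quotient oo p) : Prop := GA Hs p c ∨ GB Hs p c ∨ GN Hs p c

theorem Good_A (hβ : ∀ h, Hs h → Hs (h.trans bet.symm))
    {p : UU} {c} (h : Good Hs p c) (hp : regA p) : GA Hs p c := by
  rcases h with h | h | h
  · exact h
  · exact GB_to_GA hβ h hp
  · exact GB_to_GA hβ (GN_to_GB h hp.1) hp

theorem Good_B (hα : ∀ h, Hs h → Hs (h.trans alp.symm))
    {p : UU} {c} (h : Good Hs p c) (hp : regB p) : GB Hs p c := by
  rcases h with h | h | h
  · exact GA_to_GB hα h hp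
  · exact h
  · exact GN_to_GB h hp.1

theorem regB_mB (s : SB) : regB (mB s) :=
  ⟨mB_y s, by rw [mB_wv]; exact Complex.exp_ne_zero _, by rw [mB_u]; exact s.2⟩

theorem regA_mA (s : SA) : regA (mA s) :=
  ⟨mA_y s, by rw [mA_xv]; exact Complex.exp_ne_zero _, by rw [mA_u]; exact s.2⟩

theorem Good_N (hα : ∀ h, Hs h → Hs (h.trans alp.symm))
    {p : UU} {c} (h : Good Hs p c) (hp : regN p) : GN Hs p c := by
  rcases h with h | h | h
  · refine GB_to_GN (GA_to_GB hα h ?_) hp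
    obtain ⟨g, hg, s, hs, rfl⟩ := h
    have hy : (nOf p hp).1.1 ≠ 0 := by
      rw [← mN_y, mN_nOf, ← hs]; exact mA_y s
    obtain ⟨s', hs'⟩ := regB_of_N _ hy
    rw [← mN_nOf p hp, ← hs']
    exact regB_mB s'
  · exact GB_to_GN h hp
  · exact h

theorem all_good (h1 : Hs (.refl oo)) (hα : ∀ h, Hs h → Hs (h.trans alp.symm))
    (hβ : ∀ h, Hs h → Hs (h.trans bet.symm)) : ∀ p c, Good Hs p c := by
  apply propagate
  · left
    refine ⟨_, h1, sA0, mA0, ?_⟩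
    rw [PP_self, Path.Homotopic.Quotient.trans_refl]
  · intro p
    by_cases hy : rep p 1 = 0
    · refine ⟨_, isOpen_regN, regN_of p hy, ?_⟩
      intro a b γ hγ c hc
      have ha : regN a := by have := hγ 0; rwa [γ.source] at this
      exact Or.inr (Or.inr (GN_path γ hγ c (Good_N hα hc ha)))
    rcases reg_cover p hy with hp | hp
    · refine ⟨{q | regA q ∧ xv (rep q) / xv (rep p) ∈ slitPlane}, ?_, ⟨hp, ?_⟩, ?_⟩
      · rw [isOpen_iff_mem_nhds]
        rintro q ⟨hq, hq'⟩
        filter_upwards [isOpen_regA.mem_nhds hq, ((contAt_xr q hq.1).div_const _).eventually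
          (Complex.isOpen_slitPlane.mem_nhds hq')] with r a b
        exact ⟨a, b⟩
      · rw [div_self hp.2.1]; exact Complex.one_mem_slitPlane
      · intro a b γ hγ c hc
        have ha : regA a := by have := (hγ 0).1; rwa [γ.source] at this
        exact Or.inl (GA_path γ _ hp.2.1 (fun t => (hγ t).1) (fun t => (hγ t).2) c
          (Good_A hβ hc ha))
    · refine ⟨{q | regB q ∧ wv (rep q) / wv (rep p) ∈ slitPlane}, ?_, ⟨hp, ?_⟩, ?_⟩
      · rw [isOpen_iff_mem_nhds]
        rintro q ⟨hq, hq'⟩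
        filter_upwards [isOpen_regB.mem_nhds hq, ((contAt_wr q hq.1).div_const _).eventually
          (Complex.isOpen_slitPlane.mem_nhds hq')] with r a b
        exact ⟨a, b⟩
      · rw [div_self hp.2.1]; exact Complex.one_mem_slitPlane
      · intro a b γ hγ c hc
        have ha : regB a := by have := (hγ 0).1; rwa [γ.source] at this
        exact Or.inr (Or.inl (GB_path γ _ hp.2.1 (fun t => (hγ t).1) (fun t => (hγ t).2) c
          (Good_B hα hc ha)))

theorem stab (hα : ∀ h, Hs h → Hs (h.trans alp.symm)) (n : ℤ) :
    ∀ g, Hs g → ∀ (s : SA) (hs : mA s = oo), s.1.1 = n * (Real.pi * Complex.I) →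
      Hs (g.trans (PP mA sA0 s mA0 hs)) := by
  induction n using Int.induction_on with
  | zero =>
    intro g hg s hs h
    have : s = sA0 := by
      have h1 : s.1.1 = 0 := by simpa using h
      apply Subtype.ext
      apply Prod.ext
      · simpa [sA0] using h1
      · have h2 := mA_wv s
        rw [hs, oo, mA_wv] at h2
        simpa [h1, sA0] using h2.symm
    subst this
    rw [PP_self, Path.Homotopic.Quotient.trans_refl]
    exact hg
  | succ n ih =>
    intro g hg s hs h
    let s' : SA := ⟨(s.1.1 - Real.pi * Complex.I, - s.1.2), by simpa using s.2⟩
    have e : thA s' = s := by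
      apply Subtype.ext
      apply Prod.ext <;> simp [thA, s']
    have hs' : mA s' = oo := by rw [← mA_thA, e, hs]
    have hh : PP mA sA0 s mA0 hs = alp.trans (PP mA sA0 s' mA0 hs') := by
      have := PP_thA s' hs' (by rw [e, hs])
      simpa only [e] using this
    rw [hh, ← Path.Homotopic.Quotient.trans_assoc]
    refine ih _ ?_ s' hs' ?_
    · have := hα g hg
      rwa [alp_symm] at this
    · simp only [s', h]; push_cast; ring
  | pred n ih =>
    intro g hg s hs h
    have hth : mA (thA s) = oo := (mA_thA s).trans hs
    have := ih (g.trans alp.symm) (hα g hg) (thA s) hth (by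
      simp only [thA, h]; push_cast; ring)
    rw [PP_thA s hs hth, Path.Homotopic.Quotient.trans_assoc,
      ← Path.Homotopic.Quotient.trans_assoc alp.symm, Path.Homotopic.Quotient.symm_trans,
      Path.Homotopic.Quotient.refl_trans] at this
    exact this

theorem generation (h1 : Hs (.refl oo)) (hα : ∀ h, Hs h → Hs (h.trans alp.symm))
    (hβ : ∀ h, Hs h → Hs (h.trans bet.symm)) (c : Path.Homotopic.Quotient oo oo) : Hs c := by
  obtain ⟨g, hg, s, hs, rfl⟩ := Good_A hβ (all_good h1 hα hβ oo c) (regA_mA _)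
  have h2 := mA_xv s
  rw [hs, oo, mA_xv] at h2
  simp only [sA0, mul_zero, Complex.exp_zero] at h2
  obtain ⟨n, hn⟩ := Complex.exp_eq_one_iff.1 h2.symm
  exact stab hα n g hg s hs (by linear_combination hn / 2)

instance : PathConnectedSpace UU := by
  have hA : ∀ s : SA, Joined oo (mA s) := fun s =>
    ⟨(PathConnectedSpace.somePath sA0 s).map mA.continuous⟩
  have hB : ∀ s : SB, Joined oo (mB s) := fun s =>
    ⟨((PathConnectedSpace.somePath sB0 s).map mB.continuous).cast mB0.symm rfl⟩
  have key : ∀ p : UU, Joined oo p := by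
    intro p
    by_cases hy : rep p 1 = 0
    · have hp := regN_of p hy
      let n : SN := ⟨(1 / 4, 0), by norm_num⟩
      obtain ⟨s, hs⟩ := regB_of_N n (by norm_num [n])
      have h1 : Joined (mN n) (mN (nOf p hp)) :=
        ⟨(PathConnectedSpace.somePath n (nOf p hp)).map mN.continuous⟩
      rw [mN_nOf, ← hs] at h1
      exact (hB s).trans h1
    rcases reg_cover p hy with hp | hp
    · have hx := hp.2.1
      have hne := Complex.exp_ne_zero (log (xv (rep p)) / 2)
      have he : exp (log (xv (rep p)) / 2) ^ 2 = xv (rep p) := by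
        rw [← exp2, mul_div_cancel₀ _ (by norm_num), Complex.exp_log hx]
      let s : SA := ⟨(log (xv (rep p)) / 2, wv (rep p) / exp (log (xv (rep p)) / 2) ^ 3), by
        convert hp.2.2 using 2
        simp only
        rw [div_pow, ← pow_mul, mul_comm 3 2, pow_mul, he]⟩
      have : mA s = p := by
        apply eq_of_xw (mA_y _) hy
        · rw [mA_xv, exp2]; exact he
        · rw [mA_wv, exp3]; simp only [s]; field_simp
      rw [← this]; exact hA s
    · have hx := hp.2.1
      have hne := Complex.exp_ne_zero (log (wv (rep p)) / 3)
      have he : exp (log (wv (rep p)) / 3) ^ 3 = wv (rep p) := by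
        rw [← exp3, mul_div_cancel₀ _ (by norm_num), Complex.exp_log hx]
      let s : SB := ⟨(log (wv (rep p)) / 3, xv (rep p) / exp (log (wv (rep p)) / 3) ^ 2), by
        convert hp.2.2 using 2
        simp only
        rw [div_pow, ← pow_mul, mul_comm 2 3, pow_mul, he]⟩
      have : mB s = p := by
        apply eq_of_xw (mB_y _) hy
        · rw [mB_xv, exp2]; simp only [s]; field_simp
        · rw [mB_wv, exp3]; exact he
      rw [← this]; exact hB s
  exact ⟨⟨oo⟩, fun p q => (key p).symm.trans (key q)⟩

end Gener

section Mono
open Complex (exp log slitPlane)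

theorem omg_ne : omg ≠ 1 := by
  intro h
  rw [omg, Complex.exp_eq_one_iff] at h
  obtain ⟨n, hn⟩ := h
  have h3 : (2 * Real.pi * Complex.I : ℂ) ≠ 0 := Complex.two_pi_I_ne_zero
  have h4 : (1 : ℂ) = 3 * n := by
    apply mul_left_cancel₀ h3
    linear_combination 3 * hn
  have h5 : (1 : ℤ) = 3 * n := by exact_mod_cast h4
  omega

theorem omg_sq_ne : omg * omg ≠ 1 := by
  intro h
  apply omg_ne
  linear_combination omg3 - omg * h

theorem omg_sq_ne' : omg * omg ≠ omg := by
  intro h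
  apply omg_ne
  linear_combination omg3 - (omg + 1) * h

theorem evconst {Y : Type*} [TopologicalSpace Y] (f : Y → ℂ) (y : Y) (hc : ContinuousAt f y)
    (n : ℕ) (hn : 0 < n) (h : ∀ᶠ q in 𝓝 y, f q ^ n = 1) : ∀ᶠ q in 𝓝 y, f q = f y := by
  have hfin : {z : ℂ | z ^ n = 1}.Finite := by
    refine Set.Finite.subset (Polynomial.nthRoots n (1 : ℂ)).toFinset.finite_toSet ?_
    intro z hz
    simpa [Polynomial.mem_nthRoots hn] using hz
  have hcl : IsClosed ({z : ℂ | z ^ n = 1} \ {f y}) := (hfin.subset sdiff_subset).isClosed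
  have := hc.eventually (hcl.isOpen_compl.mem_nhds (by simp))
  filter_upwards [h, this] with q h1 h2
  by_contra hne
  exact h2 ⟨h1, hne⟩

def E (n : ℂ) (z : ℂ) : ℂ := exp (log z / n)

theorem E_pow (n : ℕ) (hn : n ≠ 0) {z : ℂ} (hz : z ≠ 0) : E n z ^ n = z := by
  rw [E, ← Complex.exp_nat_mul, mul_div_cancel₀ _ (by exact_mod_cast hn), Complex.exp_log hz]

theorem E2_pow {z : ℂ} (hz : z ≠ 0) : E 2 z ^ 2 = z := by exact_mod_cast E_pow 2 two_ne_zero hz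
theorem E3_pow {z : ℂ} (hz : z ≠ 0) : E 3 z ^ 3 = z := by exact_mod_cast E_pow 3 three_ne_zero hz
theorem E6_pow (z : ℂ) : E 6 z ^ 3 = E 2 z := by
  rw [E, E, ← Complex.exp_nat_mul]; congr 1; push_cast; ring
theorem E_ne (n z : ℂ) : E n z ≠ 0 := Complex.exp_ne_zero _
theorem E_one (n : ℂ) : E n 1 = 1 := by simp [E]
theorem E_cont {X : Type*} [TopologicalSpace X] (n : ℂ) (g : X → ℂ) (x : X)
    (hg : ContinuousAt g x) (h : g x ∈ slitPlane) : ContinuousAt (fun x => E n (g x)) x := by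
  unfold E
  have := hg.clog h
  exact Complex.continuous_exp.continuousAt.comp (this.div_const n)

def uu (v : Fin 3 → ℂ) : ℂ := f3 v ^ 2 / f2 v ^ 3
def tt (v : Fin 3 → ℂ) : ℂ := f3 v / (f2 v * E 2 (uu v))
def sx (v : Fin 3 → ℂ) : ℂ := tt v * E 6 (uu v)
open Classical in
def refA (v : Fin 3 → ℂ) : ℂ := if uu v ∈ slitPlane then tt v else E 2 (f2 v)
open Classical in
def refB (v : Fin 3 → ℂ) : ℂ := if uu v ∈ slitPlane then sx v else E 3 (f3 v)
def ell (c : ℂ × ℂ) (v : Fin 3 → ℂ) : ℂ := c.1 * v 0 + c.2 * v 1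
def rA (c : ℂ × ℂ) (v : Fin 3 → ℂ) : ℂ := ell c v * E 2 (f2 v / ell c v ^ 2)
def rB (c : ℂ × ℂ) (v : Fin 3 → ℂ) : ℂ := ell c v * E 3 (f3 v / ell c v ^ 3)
def okA (c : ℂ × ℂ) (v : Fin 3 → ℂ) : Prop :=
  1 + uu v ∈ slitPlane ∧ f2 v / ell c v ^ 2 ∈ slitPlane
def okB (c : ℂ × ℂ) (v : Fin 3 → ℂ) : Prop :=
  1 + f2 v ^ 3 / f3 v ^ 2 ∈ slitPlane ∧ f3 v / ell c v ^ 3 ∈ slitPlane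

theorem okA_ne {c v} (h : okA c v) : f2 v ≠ 0 ∧ ell c v ≠ 0 := by
  have := Complex.slitPlane_ne_zero h.2
  constructor <;> (intro h; simp [h] at this)
theorem okB_ne {c v} (h : okB c v) : f3 v ≠ 0 ∧ ell c v ≠ 0 := by
  have := Complex.slitPlane_ne_zero h.2
  constructor <;> (intro h; simp [h] at this)
theorem uu_ne {v} (h : uu v ∈ slitPlane) : f2 v ≠ 0 ∧ f3 v ≠ 0 := by
  have := Complex.slitPlane_ne_zero h
  constructor <;> (intro h; simp [uu, h] at this)
theorem okAB {c c' v} (h : okA c v) (h' : okB c' v) : uu v ∈ slitPlane := by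
  have h2 := (okA_ne h).1
  have h3 := (okB_ne h').1
  refine slit_of_both (div_ne_zero (pow_ne_zero _ h3) (pow_ne_zero _ h2)) h.1 ?_
  rw [uu, inv_div]; exact h'.1

theorem tt_sq {v} (h : uu v ∈ slitPlane) : tt v ^ 2 = f2 v := by
  obtain ⟨h2, h3⟩ := uu_ne h
  rw [tt, div_pow, mul_pow, E2_pow (Complex.slitPlane_ne_zero h), uu]
  field_simp
theorem tt_mul {v} (h : uu v ∈ slitPlane) : tt v * (f2 v * E 2 (uu v)) = f3 v := by
  obtain ⟨h2, h3⟩ := uu_ne h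
  have := E_ne 2 (uu v)
  rw [tt]; field_simp
theorem tt_ne {v} (h : uu v ∈ slitPlane) : tt v ≠ 0 := by
  intro h'; have := tt_sq h; rw [h'] at this; exact (uu_ne h).1 (by simpa using this.symm)
theorem sx_cube {v} (h : uu v ∈ slitPlane) : sx v ^ 3 = f3 v := by
  rw [sx, mul_pow, E6_pow]
  linear_combination tt_mul h + tt v * E 2 (uu v) * tt_sq h
theorem refA_sq {v} (h : f2 v ≠ 0) : refA v ^ 2 = f2 v := by
  unfold refA; split_ifs with hu
  · exact tt_sq hu
  · exact E2_pow h
theorem refB_cube {v} (h : f3 v ≠ 0) : refB v ^ 3 = f3 v := by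
  unfold refB; split_ifs with hu
  · exact sx_cube hu
  · exact E3_pow h
theorem rA_sq {c v} (h : okA c v) : rA c v ^ 2 = f2 v := by
  obtain ⟨h2, h3⟩ := okA_ne h
  rw [rA, mul_pow, E2_pow (Complex.slitPlane_ne_zero h.2)]; field_simp
theorem rB_cube {c v} (h : okB c v) : rB c v ^ 3 = f3 v := by
  obtain ⟨h2, h3⟩ := okB_ne h
  rw [rB, mul_pow, E3_pow (Complex.slitPlane_ne_zero h.2)]; field_simp

theorem ell_smul (c : ℂ × ℂ) (k : ℂ) (v) : ell c (k • v) = k * ell c v := by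
  simp [ell]; ring
theorem uu_smul (k : ℂ) (hk : k ≠ 0) (v) : uu (k • v) = uu v := by
  rw [uu, uu, f3_smul, f2_smul, mul_pow, mul_pow, ← pow_mul, ← pow_mul,
    mul_div_mul_left _ _ (pow_ne_zero _ hk)]
theorem uu'_smul (k : ℂ) (hk : k ≠ 0) (v) :
    f2 (k • v) ^ 3 / f3 (k • v) ^ 2 = f2 v ^ 3 / f3 v ^ 2 := by
  rw [f3_smul, f2_smul, mul_pow, mul_pow, ← pow_mul, ← pow_mul,
    mul_div_mul_left _ _ (pow_ne_zero _ hk)]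
theorem fl2_smul (c) (k : ℂ) (hk : k ≠ 0) (v) :
    f2 (k • v) / ell c (k • v) ^ 2 = f2 v / ell c v ^ 2 := by
  rw [f2_smul, ell_smul, mul_pow, mul_div_mul_left _ _ (pow_ne_zero _ hk)]
theorem fl3_smul (c) (k : ℂ) (hk : k ≠ 0) (v) :
    f3 (k • v) / ell c (k • v) ^ 3 = f3 v / ell c v ^ 3 := by
  rw [f3_smul, ell_smul, mul_pow, mul_div_mul_left _ _ (pow_ne_zero _ hk)]
theorem tt_smul (k : ℂ) (hk : k ≠ 0) (v) : tt (k • v) = k * tt v := by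
  rw [tt, tt, uu_smul k hk, f3_smul, f2_smul]
  rw [show k ^ 3 * f3 v = k ^ 2 * (k * f3 v) by ring, mul_assoc,
    mul_div_mul_left _ _ (pow_ne_zero _ hk), mul_div_assoc]
theorem sx_smul (k : ℂ) (hk : k ≠ 0) (v) : sx (k • v) = k * sx v := by
  rw [sx, sx, uu_smul k hk, tt_smul k hk, mul_assoc]
theorem rA_smul (c) (k : ℂ) (hk : k ≠ 0) (v) : rA c (k • v) = k * rA c v := by
  rw [rA, rA, fl2_smul c k hk, ell_smul, mul_assoc]
theorem rB_smul (c) (k : ℂ) (hk : k ≠ 0) (v) : rB c (k • v) = k * rB c v := by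
  rw [rB, rB, fl3_smul c k hk, ell_smul, mul_assoc]

@[fun_prop] theorem continuous_ell (c) : Continuous (ell c) := by unfold ell; fun_prop

theorem uu_cont {v} (h : f2 v ≠ 0) : ContinuousAt uu v := by
  unfold uu
  exact ContinuousAt.div (by fun_prop) (by fun_prop) (pow_ne_zero _ h)
theorem fl2_cont {c v} (h : ell c v ≠ 0) : ContinuousAt (fun v => f2 v / ell c v ^ 2) v :=
  ContinuousAt.div (by fun_prop) (by fun_prop) (pow_ne_zero _ h)
theorem fl3_cont {c v} (h : ell c v ≠ 0) : ContinuousAt (fun v => f3 v / ell c v ^ 3) v :=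
  ContinuousAt.div (by fun_prop) (by fun_prop) (pow_ne_zero _ h)
theorem tt_cont {v} (h : uu v ∈ slitPlane) : ContinuousAt tt v := by
  unfold tt
  obtain ⟨h2, h3⟩ := uu_ne h
  exact ContinuousAt.div (by fun_prop)
    (ContinuousAt.mul (by fun_prop) (E_cont 2 uu v (uu_cont h2) h)) (mul_ne_zero h2 (E_ne _ _))
theorem sx_cont {v} (h : uu v ∈ slitPlane) : ContinuousAt sx v := by
  unfold sx
  exact (tt_cont h).mul (E_cont 6 uu v (uu_cont (uu_ne h).1) h)
theorem rA_cont {c v} (h : okA c v) : ContinuousAt (rA c) v := by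
  unfold rA
  exact ContinuousAt.mul (by fun_prop) (E_cont 2 _ v (fl2_cont (okA_ne h).2) h.2)
theorem rB_cont {c v} (h : okB c v) : ContinuousAt (rB c) v := by
  unfold rB
  exact ContinuousAt.mul (by fun_prop) (E_cont 3 _ v (fl3_cont (okB_ne h).2) h.2)

theorem okA_smul (c) (k : ℂ) (hk : k ≠ 0) (v) (h : okA c v) : okA c (k • v) := by
  unfold okA; rwa [uu_smul k hk, fl2_smul c k hk]
theorem okB_smul (c) (k : ℂ) (hk : k ≠ 0) (v) (h : okB c v) : okB c (k • v) := by
  unfold okB; rwa [uu'_smul k hk, fl3_smul c k hk]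
theorem okA_ev {c v} (h : okA c v) : ∀ᶠ w in 𝓝 v, okA c w :=
  ((continuousAt_const.add (uu_cont (okA_ne h).1)).eventually
    (Complex.isOpen_slitPlane.mem_nhds h.1)).and
  ((fl2_cont (okA_ne h).2).eventually (Complex.isOpen_slitPlane.mem_nhds h.2))
theorem okB_ev {c v} (h : okB c v) : ∀ᶠ w in 𝓝 v, okB c w := by
  have h1 : ContinuousAt (fun v => 1 + f2 v ^ 3 / f3 v ^ 2) v :=
    continuousAt_const.add (ContinuousAt.div (by fun_prop) (by fun_prop)
      (pow_ne_zero _ (okB_ne h).1))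
  exact (h1.eventually (Complex.isOpen_slitPlane.mem_nhds h.1)).and
    ((fl3_cont (okB_ne h).2).eventually (Complex.isOpen_slitPlane.mem_nhds h.2))

theorem slit_neg {z : ℂ} (h : z ≠ 0) : z ∈ slitPlane ∨ -z ∈ slitPlane := by
  simp only [Complex.mem_slitPlane_iff, Complex.neg_re, Complex.neg_im]
  by_contra hc
  push Not at hc
  obtain ⟨⟨h1, h2⟩, h3, h4⟩ := hc
  exact h (Complex.ext (by simp; linarith) (by simpa using h2))

theorem covA {v} (h : 1 + uu v ∈ slitPlane) (h2 : f2 v ≠ 0) : ∃ c, okA c v := by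
  have hy : v 1 ≠ 0 := by intro h; simp [f2, h] at h2
  rcases slit_neg (div_ne_zero h2 (pow_ne_zero 2 hy)) with h' | h'
  · exact ⟨(0, 1), h, by simpa [ell] using h'⟩
  · exact ⟨(0, Complex.I), h, by simpa [ell, mul_pow, div_neg, neg_div] using h'⟩

theorem covB {v} (h : 1 + f2 v ^ 3 / f3 v ^ 2 ∈ slitPlane) (h3 : f3 v ≠ 0) : ∃ c, okB c v := by
  by_cases hy : v 1 = 0
  · have h4 : f3 v = - v 0 ^ 3 := by simp [f3, hy]
    refine ⟨(-1, 0), h, ?_⟩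
    have : f3 v / ell (-1, 0) v ^ 3 = 1 := by
      rw [h4] at h3 ⊢
      have : ell (-1, 0) v ^ 3 = - v 0 ^ 3 := by simp [ell]; ring
      rw [this, div_self h3]
    rw [this]; exact Complex.one_mem_slitPlane
  · rcases slit_neg (div_ne_zero h3 (pow_ne_zero 3 hy)) with h' | h'
    · exact ⟨(0, 1), h, by simpa [ell] using h'⟩
    · refine ⟨(0, -1), h, ?_⟩
      have : ell (0, -1) v ^ 3 = - v 1 ^ 3 := by simp [ell]; ring
      rw [this, div_neg]; exact h'

theorem covU (p : UU) : (∃ c, okA c (rep p)) ∨ ∃ c, okB c (rep p) := by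
  have hD : f2 (rep p) ^ 3 + f3 (rep p) ^ 2 ≠ 0 := p.2
  by_cases h2 : f2 (rep p) = 0
  · right
    refine covB (by simp [h2]) ?_
    intro h; simp [h, h2] at hD
  by_cases h3 : f3 (rep p) = 0
  · left; exact covA (by simp [uu, h3]) h2
  have : 1 + uu (rep p) ≠ 0 := by
    unfold uu
    intro h
    apply hD
    field_simp at h
    linear_combination h
  rcases slit_or this with h | h
  · exact Or.inl (covA h h2)
  · right
    refine covB ?_ h3
    rwa [uu, inv_div] at h

section G
variable {G : Type*} [Group G] (a b : G)

open Classical in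
def chi2 (z : ℂ) : G := if z = 1 then 1 else a
open Classical in
def chi3 (z : ℂ) : G := if z = 1 then 1 else if z = omg then b⁻¹ else b

variable {a b}

theorem sq1 {z : ℂ} (hz : z ^ 2 = 1) : z = 1 ∨ z = -1 := by
  have h : (z - 1) * (z + 1) = 0 := by linear_combination hz
  rcases mul_eq_zero.1 h with h | h
  · exact Or.inl (sub_eq_zero.1 h)
  · exact Or.inr (eq_neg_of_add_eq_zero_left h)

theorem chi2_mul (ha : a * a = 1) {z w : ℂ} (hz : z ^ 2 = 1) (hw : w ^ 2 = 1) :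
    chi2 a (z * w) = chi2 a z * chi2 a w := by
  have h1 : (-1 : ℂ) ≠ 1 := by norm_num
  rcases sq1 hz with rfl | rfl <;>
    rcases sq1 hw with rfl | rfl <;> simp [chi2, h1, ha]

theorem cube1 {z : ℂ} (hz : z ^ 3 = 1) : z = 1 ∨ z = omg ∨ z = omg * omg := by
  have := cube_cases (μ := z) (η := 1) (by rw [hz]; ring)
  simpa using this

theorem chi3_mul (hb : b * b * b = 1) {z w : ℂ} (hz : z ^ 3 = 1) (hw : w ^ 3 = 1) :
    chi3 b (z * w) = chi3 b z * chi3 b w := by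
  have e1 : omg * (omg * omg) = 1 := by rw [← omg3]; ring
  have e2 : (omg * omg) * omg = 1 := by rw [← omg3]; ring
  have e3 : (omg * omg) * (omg * omg) = omg := by linear_combination omg * omg3
  have hb2 : b⁻¹ = b * b := (eq_inv_of_mul_eq_one_left hb).symm
  have hb3 : b⁻¹ * b⁻¹ = b := by rw [← mul_inv_rev, ← hb2, inv_inv]
  rcases cube1 hz with rfl | rfl | rfl <;>
    rcases cube1 hw with rfl | rfl | rfl <;>
    simp [chi3, e1, e2, e3, omg_ne, omg_sq_ne, omg_sq_ne', hb3, -mul_eq_left₀, -mul_eq_right₀]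
  exact hb2

end G

end Mono

section Mono2
open Complex (exp log slitPlane)

variable {G : Type*} [Group G] {a b : G}

theorem ne_of_pow {x f : ℂ} (n : ℕ) (hn : n ≠ 0) (hf : f ≠ 0) (h : x ^ n = f) : x ≠ 0 := by
  rintro rfl; rw [zero_pow hn] at h; exact hf h.symm

theorem div_pow_one {x y f : ℂ} (n : ℕ) (hf : f ≠ 0) (h : x ^ n = f) (h' : y ^ n = f) :
    (x / y) ^ n = 1 := by
  rw [div_pow, h, h', div_self hf]

theorem chi2_div (ha : a * a = 1) {x y z f : ℂ} (hf : f ≠ 0) (hx : x ^ 2 = f) (hy : y ^ 2 = f)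
    (hz : z ^ 2 = f) : chi2 a (x / z) * chi2 a (z / y) = chi2 a (x / y) := by
  rw [← chi2_mul ha (div_pow_one 2 hf hx hz) (div_pow_one 2 hf hz hy),
    div_mul_div_cancel₀ (ne_of_pow 2 two_ne_zero hf hz)]

theorem chi3_div (hb : b * b * b = 1) {x y z f : ℂ} (hf : f ≠ 0) (hx : x ^ 3 = f) (hy : y ^ 3 = f)
    (hz : z ^ 3 = f) : chi3 b (x / z) * chi3 b (z / y) = chi3 b (x / y) := by
  rw [← chi3_mul hb (div_pow_one 3 hf hx hz) (div_pow_one 3 hf hz hy),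
    div_mul_div_cancel₀ (ne_of_pow 3 three_ne_zero hf hz)]

def bs : Bool × ℂ × ℂ → Set UU
  | (true, c) => {p | okA c (rep p)}
  | (false, c) => {p | okB c (rep p)}

variable (a b) in
def ss : Bool × ℂ × ℂ → UU → G
  | (true, c) => fun p => chi2 a (rA c (rep p) / refA (rep p))
  | (false, c) => fun p => chi3 b (rB c (rep p) / refB (rep p))

theorem bs_open (i) : IsOpen (bs i) := by
  rcases i with ⟨_ | _, c⟩
  · exact isOpen_rep (okB c) (fun k hk v => okB_smul c k hk v) (fun v => okB_ev)
  · exact isOpen_rep (okA c) (fun k hk v => okA_smul c k hk v) (fun v => okA_ev)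

theorem mem_bsA {c} {p : UU} (h : okA c (rep p)) : p ∈ bs (true, c) := h
theorem mem_bsB {c} {p : UU} (h : okB c (rep p)) : p ∈ bs (false, c) := h

theorem bs_cov (p : UU) : ∃ i, p ∈ bs i := by
  rcases covU p with ⟨c, hc⟩ | ⟨c, hc⟩
  · exact ⟨(true, c), hc⟩
  · exact ⟨(false, c), hc⟩

theorem quot_smul {F H : (Fin 3 → ℂ) → ℂ} (hF : ∀ k : ℂ, k ≠ 0 → ∀ v, F (k • v) = k * F v)
    (hH : ∀ k : ℂ, k ≠ 0 → ∀ v, H (k • v) = k * H v) (k : ℂ) (hk : k ≠ 0) (v) :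
    F (k • v) / H (k • v) = F v / H v := by
  rw [hF k hk, hH k hk, mul_div_mul_left _ _ hk]

theorem quot_cont {F H : (Fin 3 → ℂ) → ℂ} (hF : ∀ k : ℂ, k ≠ 0 → ∀ v, F (k • v) = k * F v)
    (hH : ∀ k : ℂ, k ≠ 0 → ∀ v, H (k • v) = k * H v) (p : UU)
    (cF : ContinuousAt F (rep p)) (cH : ContinuousAt H (rep p)) (h : H (rep p) ≠ 0) :
    ContinuousAt (fun q : UU => F (rep q) / H (rep q)) p :=
  contAt_rep (fun v => F v / H v) (quot_smul hF hH) p (cF.div cH h)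

theorem ev_ok {c} {p : UU} (h : okA c (rep p)) : ∀ᶠ q in 𝓝 p, okA c (rep q) :=
  (bs_open (true, c)).mem_nhds h
theorem ev_okB {c} {p : UU} (h : okB c (rep p)) : ∀ᶠ q in 𝓝 p, okB c (rep q) :=
  (bs_open (false, c)).mem_nhds h

theorem ss_AA (ha : a * a = 1) {c d} {p : UU} (hc : okA c (rep p)) (hd : okA d (rep p)) :
    ∀ᶠ q in 𝓝 p, ss a b (true, d) q * (ss a b (true, c) q)⁻¹
      = ss a b (true, d) p * (ss a b (true, c) p)⁻¹ := by
  have key : ∀ q : UU, okA c (rep q) → okA d (rep q) →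
      ss a b (true, d) q * (ss a b (true, c) q)⁻¹ = chi2 a (rA d (rep q) / rA c (rep q)) := by
    intro q hc hd
    have hf := (okA_ne hc).1
    rw [mul_inv_eq_iff_eq_mul]
    exact (chi2_div ha hf (rA_sq hd) (refA_sq hf) (rA_sq hc)).symm
  have h0 := ne_of_pow 2 two_ne_zero (okA_ne hc).1 (rA_sq hc)
  have := evconst _ p (quot_cont (rA_smul d) (rA_smul c) p (rA_cont hd) (rA_cont hc) h0) 2 two_pos
    (by filter_upwards [ev_ok hc, ev_ok hd] with q h1 h2
        exact div_pow_one 2 (okA_ne h1).1 (rA_sq h2) (rA_sq h1))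
  filter_upwards [ev_ok hc, ev_ok hd, this] with q h1 h2 h3
  rw [key q h1 h2, key p hc hd, h3]

theorem ss_BB (hb : b * b * b = 1) {c d} {p : UU} (hc : okB c (rep p)) (hd : okB d (rep p)) :
    ∀ᶠ q in 𝓝 p, ss a b (false, d) q * (ss a b (false, c) q)⁻¹
      = ss a b (false, d) p * (ss a b (false, c) p)⁻¹ := by
  have key : ∀ q : UU, okB c (rep q) → okB d (rep q) →
      ss a b (false, d) q * (ss a b (false, c) q)⁻¹ = chi3 b (rB d (rep q) / rB c (rep q)) := by
    intro q hc hd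
    have hf := (okB_ne hc).1
    rw [mul_inv_eq_iff_eq_mul]
    exact (chi3_div hb hf (rB_cube hd) (refB_cube hf) (rB_cube hc)).symm
  have h0 := ne_of_pow 3 three_ne_zero (okB_ne hc).1 (rB_cube hc)
  have := evconst _ p (quot_cont (rB_smul d) (rB_smul c) p (rB_cont hd) (rB_cont hc) h0) 3
    three_pos
    (by filter_upwards [ev_okB hc, ev_okB hd] with q h1 h2
        exact div_pow_one 3 (okB_ne h1).1 (rB_cube h2) (rB_cube h1))
  filter_upwards [ev_okB hc, ev_okB hd, this] with q h1 h2 h3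
  rw [key q h1 h2, key p hc hd, h3]

theorem ev_uu {p : UU} (h : uu (rep p) ∈ slitPlane) : ∀ᶠ q in 𝓝 p, uu (rep q) ∈ slitPlane :=
  ev_rep (fun v => uu v ∈ slitPlane) (fun k hk v h => by rwa [uu_smul k hk]) p
    ((uu_cont (uu_ne h).1).eventually (Complex.isOpen_slitPlane.mem_nhds h))

theorem ss_A {c} {p : UU} (hc : okA c (rep p)) (hu : uu (rep p) ∈ slitPlane) :
    ∀ᶠ q in 𝓝 p, ss a b (true, c) q = ss a b (true, c) p := by
  have key : ∀ q : UU, uu (rep q) ∈ slitPlane →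
      ss a b (true, c) q = chi2 a (rA c (rep q) / tt (rep q)) := by
    intro q hq
    simp only [ss, refA, if_pos hq]
  have := evconst _ p (quot_cont (rA_smul c) tt_smul p (rA_cont hc) (tt_cont hu) (tt_ne hu)) 2
    two_pos
    (by filter_upwards [ev_ok hc, ev_uu hu] with q h1 h2
        exact div_pow_one 2 (okA_ne h1).1 (rA_sq h1) (tt_sq h2))
  filter_upwards [ev_uu hu, this] with q h2 h3
  rw [key q h2, key p hu, h3]

theorem ss_B {c} {p : UU} (hc : okB c (rep p)) (hu : uu (rep p) ∈ slitPlane) :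
    ∀ᶠ q in 𝓝 p, ss a b (false, c) q = ss a b (false, c) p := by
  have key : ∀ q : UU, uu (rep q) ∈ slitPlane →
      ss a b (false, c) q = chi3 b (rB c (rep q) / sx (rep q)) := by
    intro q hq
    simp only [ss, refB, if_pos hq]
  have := evconst _ p (quot_cont (rB_smul c) sx_smul p (rB_cont hc) (sx_cont hu)
      (mul_ne_zero (tt_ne hu) (E_ne _ _))) 3 three_pos
    (by filter_upwards [ev_okB hc, ev_uu hu] with q h1 h2
        exact div_pow_one 3 (okB_ne h1).1 (rB_cube h1) (sx_cube h2))
  filter_upwards [ev_uu hu, this] with q h2 h3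
  rw [key q h2, key p hu, h3]

theorem ss_trans (ha : a * a = 1) (hb : b * b * b = 1) (i j) (p : UU) (hp : p ∈ bs i ∩ bs j) :
    ∀ᶠ q in 𝓝 p, ss a b j q * (ss a b i q)⁻¹ = ss a b j p * (ss a b i p)⁻¹ := by
  rcases i with ⟨_ | _, c⟩ <;> rcases j with ⟨_ | _, d⟩
  · exact ss_BB hb hp.1 hp.2
  · have hu := okAB hp.2 hp.1
    filter_upwards [ss_A (a := a) (b := b) hp.2 hu, ss_B (a := a) (b := b) hp.1 hu] with q h1 h2
    rw [h1, h2]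
  · have hu := okAB hp.1 hp.2
    filter_upwards [ss_A (a := a) (b := b) hp.1 hu, ss_B (a := a) (b := b) hp.2 hu] with q h1 h2
    rw [h1, h2]
  · exact ss_AA ha hp.1 hp.2

theorem f2_xv {v : Fin 3 → ℂ} (h : v 1 ≠ 0) : f2 v = xv v * v 1 ^ 2 := by
  unfold f2 xv; field_simp
theorem f3_wv {v : Fin 3 → ℂ} (h : v 1 ≠ 0) : f3 v = wv v * v 1 ^ 3 := by
  unfold wv; field_simp

theorem y_smul (k : ℂ) (_ : k ≠ 0) (v : Fin 3 → ℂ) : (k • v) 1 = k * v 1 := rfl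

theorem rep_oo : uu (rep oo) = 1 ∧ f2 (rep oo) = rep oo 1 ^ 2 ∧ f3 (rep oo) = rep oo 1 ^ 3 := by
  have hy : rep oo 1 ≠ 0 := mA_y sA0
  have h1 : xv (rep oo) = 1 := by rw [oo, mA_xv]; simp [sA0]
  have h2 : wv (rep oo) = 1 := by rw [oo, mA_wv]; simp [sA0]
  have e1 : f2 (rep oo) = rep oo 1 ^ 2 := by rw [f2_xv hy, h1, one_mul]
  have e2 : f3 (rep oo) = rep oo 1 ^ 3 := by rw [f3_wv hy, h2, one_mul]
  refine ⟨?_, e1, e2⟩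
  rw [uu, e1, e2]; field_simp

theorem tt_oo : tt (rep oo) = rep oo 1 := by
  have hy : rep oo 1 ≠ 0 := mA_y sA0
  obtain ⟨h1, h2, h3⟩ := rep_oo
  rw [tt, h1, h2, h3, E_one]; field_simp

theorem refA_oo : refA (rep oo) = rep oo 1 := by
  rw [refA, if_pos, tt_oo]
  rw [rep_oo.1]; exact Complex.one_mem_slitPlane

theorem refB_oo : refB (rep oo) = rep oo 1 := by
  rw [refB, if_pos, sx, tt_oo, rep_oo.1, E_one, mul_one]
  rw [rep_oo.1]; exact Complex.one_mem_slitPlane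

theorem mA_f2 (s : SA) : (rep (mA s) 1 * exp s.1.1) ^ 2 = f2 (rep (mA s)) := by
  rw [f2_xv (mA_y s), mA_xv, exp2]; ring
theorem mA_f2_ne (s : SA) : f2 (rep (mA s)) ≠ 0 := by
  rw [← mA_f2]; exact pow_ne_zero _ (mul_ne_zero (mA_y s) (Complex.exp_ne_zero _))
theorem mB_f3 (s : SB) : (rep (mB s) 1 * exp s.1.1) ^ 3 = f3 (rep (mB s)) := by
  rw [f3_wv (mB_y s), mB_wv, exp3]; ring
theorem mB_f3_ne (s : SB) : f3 (rep (mB s)) ≠ 0 := by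
  rw [← mB_f3]; exact pow_ne_zero _ (mul_ne_zero (mB_y s) (Complex.exp_ne_zero _))

theorem mA_ok (s : SA) : ∃ c, okA c (rep (mA s)) := by
  refine covA ?_ (mA_f2_ne s)
  have : uu (rep (mA s)) = s.1.2 ^ 2 := by
    have hy := mA_y s
    rw [← mA_u s, uu, f2_xv hy, f3_wv hy, mul_pow, mul_pow, ← pow_mul, ← pow_mul,
      mul_div_mul_right _ _ (pow_ne_zero _ hy)]
  rw [this]; exact s.2

theorem mB_ok (s : SB) : ∃ c, okB c (rep (mB s)) := by
  refine covB ?_ (mB_f3_ne s)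
  have : f2 (rep (mB s)) ^ 3 / f3 (rep (mB s)) ^ 2 = s.1.2 ^ 3 := by
    have hy := mB_y s
    rw [← mB_u s, f2_xv hy, f3_wv hy, mul_pow, mul_pow, ← pow_mul, ← pow_mul,
      mul_div_mul_right _ _ (pow_ne_zero _ hy)]
  rw [this]; exact s.2

theorem liftA (ha : a * a = 1) (q : I → UU) (hq : Continuous q) (ξ : I → ℂ) (hξ : Continuous ξ)
    (hy : ∀ t, rep (q t) 1 ≠ 0) (h2 : ∀ t, (rep (q t) 1 * exp (ξ t)) ^ 2 = f2 (rep (q t)))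
    (hok : ∀ t, ∃ c, okA c (rep (q t))) (g : G) (τ : I) :
    ∃ i, q τ ∈ bs i ∧ ∀ᶠ t in 𝓝 τ,
      ss a b i (q t) * (chi2 a (refA (rep (q t)) / (rep (q t) 1 * exp (ξ t))) * g)
      = ss a b i (q τ) * (chi2 a (refA (rep (q τ)) / (rep (q τ) 1 * exp (ξ τ))) * g) := by
  obtain ⟨c, hc⟩ := hok τ
  refine Exists.intro (true, c) (And.intro (mem_bsA hc) ?_)
  have hev : ∀ᶠ t in 𝓝 τ, okA c (rep (q t)) := hq.continuousAt.eventually (ev_ok hc)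
  have hf : ∀ t, f2 (rep (q t)) ≠ 0 := fun t => by
    rw [← h2 t]; exact pow_ne_zero _ (mul_ne_zero (hy t) (Complex.exp_ne_zero _))
  have key : ∀ t, okA c (rep (q t)) → ss a b (true, c) (q t) *
      (chi2 a (refA (rep (q t)) / (rep (q t) 1 * exp (ξ t))) * g) =
      chi2 a (rA c (rep (q t)) / (rep (q t) 1 * exp (ξ t))) * g := by
    intro t ht
    rw [← mul_assoc]
    exact congrArg (· * g) (chi2_div ha (hf t) (rA_sq ht) (h2 t) (refA_sq (hf t)))
  have c1 : ContinuousAt (fun t => rA c (rep (q t)) / rep (q t) 1) τ := by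
    have c0 : ContinuousAt (fun p : UU => rA c (rep p) / rep p 1) (q τ) :=
      quot_cont (H := fun v => v 1) (rA_smul c) y_smul (q τ) (rA_cont hc)
        (continuous_apply 1).continuousAt (hy _)
    exact Filter.Tendsto.comp c0 hq.continuousAt
  have c2 : ContinuousAt (fun t => rA c (rep (q t)) / (rep (q t) 1 * exp (ξ t))) τ := by
    have c3 : ContinuousAt (fun t => exp (ξ t)) τ := by fun_prop
    simp only [← div_div]
    exact c1.div c3 (Complex.exp_ne_zero _)
  have h5 : ∀ᶠ t in 𝓝 τ, (rA c (rep (q t)) / (rep (q t) 1 * exp (ξ t))) ^ 2 = 1 :=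
    hev.mono fun t ht => div_pow_one 2 (hf t) (rA_sq ht) (h2 t)
  have h6 := evconst _ τ c2 2 two_pos h5
  refine (hev.and h6).mono fun t ht => ?_
  rw [key t ht.1, key τ hc, ht.2]

theorem liftB (hb : b * b * b = 1) (q : I → UU) (hq : Continuous q) (ξ : I → ℂ) (hξ : Continuous ξ)
    (hy : ∀ t, rep (q t) 1 ≠ 0) (h2 : ∀ t, (rep (q t) 1 * exp (ξ t)) ^ 3 = f3 (rep (q t)))
    (hok : ∀ t, ∃ c, okB c (rep (q t))) (g : G) (τ : I) :
    ∃ i, q τ ∈ bs i ∧ ∀ᶠ t in 𝓝 τ,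
      ss a b i (q t) * (chi3 b (refB (rep (q t)) / (rep (q t) 1 * exp (ξ t))) * g)
      = ss a b i (q τ) * (chi3 b (refB (rep (q τ)) / (rep (q τ) 1 * exp (ξ τ))) * g) := by
  obtain ⟨c, hc⟩ := hok τ
  refine Exists.intro (false, c) (And.intro (mem_bsB hc) ?_)
  have hev : ∀ᶠ t in 𝓝 τ, okB c (rep (q t)) := hq.continuousAt.eventually (ev_okB hc)
  have hf : ∀ t, f3 (rep (q t)) ≠ 0 := fun t => by
    rw [← h2 t]; exact pow_ne_zero _ (mul_ne_zero (hy t) (Complex.exp_ne_zero _))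
  have key : ∀ t, okB c (rep (q t)) → ss a b (false, c) (q t) *
      (chi3 b (refB (rep (q t)) / (rep (q t) 1 * exp (ξ t))) * g) =
      chi3 b (rB c (rep (q t)) / (rep (q t) 1 * exp (ξ t))) * g := by
    intro t ht
    rw [← mul_assoc]
    exact congrArg (· * g) (chi3_div hb (hf t) (rB_cube ht) (h2 t) (refB_cube (hf t)))
  have c1 : ContinuousAt (fun t => rB c (rep (q t)) / rep (q t) 1) τ := by
    have c0 : ContinuousAt (fun p : UU => rB c (rep p) / rep p 1) (q τ) :=
      quot_cont (H := fun v => v 1) (rB_smul c) y_smul (q τ) (rB_cont hc)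
        (continuous_apply 1).continuousAt (hy _)
    exact Filter.Tendsto.comp c0 hq.continuousAt
  have c2 : ContinuousAt (fun t => rB c (rep (q t)) / (rep (q t) 1 * exp (ξ t))) τ := by
    have c3 : ContinuousAt (fun t => exp (ξ t)) τ := by fun_prop
    simp only [← div_div]
    exact c1.div c3 (Complex.exp_ne_zero _)
  have h5 : ∀ᶠ t in 𝓝 τ, (rB c (rep (q t)) / (rep (q t) 1 * exp (ξ t))) ^ 3 = 1 :=
    hev.mono fun t ht => div_pow_one 3 (hf t) (rB_cube ht) (h2 t)
  have h6 := evconst _ τ c2 3 three_pos h5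
  refine (hev.and h6).mono fun t ht => ?_
  rw [key t ht.1, key τ hc, ht.2]

theorem monodromy (ha : a * a = 1) (hb : b * b * b = 1) :
    ∃ M : FundamentalGroup UU oo →* Equiv.Perm G,
      (∀ g, M (FundamentalGroup.fromPath alp) g = a * g) ∧
      (∀ g, M (FundamentalGroup.fromPath bet) g = b * g) := by
  obtain ⟨M, hM⟩ := exists_monodromy bs bs_open bs_cov (ss a b) (ss_trans ha hb) oo
  refine ⟨M, fun g => ?_, fun g => ?_⟩
  · let δ : Path sA0 (thA sA0) := PathConnectedSpace.somePath sA0 (thA sA0)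
    have : M (FundamentalGroup.fromPath alp) _ = _ :=
      hM ((δ.map mA.continuous).cast mA0.symm ((mA_thA _).trans mA0).symm) _
        (liftA (b := b) ha (fun t => mA (δ t)) (by fun_prop) (fun t => (δ t).1.1) (by fun_prop)
          (fun t => mA_y _) (fun t => mA_f2 _) (fun t => mA_ok _) g)
    have hy : rep oo 1 ≠ 0 := mA_y sA0
    simp only [Path.source, Path.target, mA_thA, mA0, refA_oo] at this
    have e0 : rep oo 1 / (rep oo 1 * exp sA0.1.1) = 1 := by simp [sA0, hy]
    have e1 : rep oo 1 / (rep oo 1 * exp (thA sA0).1.1) = -1 := by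
      simp [sA0, thA, hy, Complex.exp_pi_mul_I]
    rw [e0, e1] at this
    have h1 : (-1 : ℂ) ≠ 1 := by norm_num
    simpa [chi2, h1] using this
  · let δ : Path sB0 (thB sB0) := PathConnectedSpace.somePath sB0 (thB sB0)
    have : M (FundamentalGroup.fromPath bet) _ = _ :=
      hM ((δ.map mB.continuous).cast mB0.symm ((mB_thB _).trans mB0).symm) _
        (liftB (a := a) hb (fun t => mB (δ t)) (by fun_prop) (fun t => (δ t).1.1) (by fun_prop)
          (fun t => mB_y _) (fun t => mB_f3 _) (fun t => mB_ok _) g)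
    have hy : rep oo 1 ≠ 0 := mA_y sA0
    simp only [Path.source, Path.target, mB_thB, mB0, refB_oo] at this
    have e0 : rep oo 1 / (rep oo 1 * exp sB0.1.1) = 1 := by simp [sB0, hy]
    have e1 : rep oo 1 / (rep oo 1 * exp (thB sB0).1.1) = omg * omg := by
      have : exp (thB sB0).1.1 = omg := by simp [sB0, thB, omg]
      rw [this]
      have h0 : omg ≠ 0 := Complex.exp_ne_zero _
      rw [div_eq_iff (mul_ne_zero hy h0)]
      linear_combination - rep oo 1 * omg3
    rw [e0, e1] at this
    simpa [chi3, omg_sq_ne, omg_sq_ne', -mul_eq_left₀, -mul_eq_right₀] using this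

end Mono2

section Fin
open Monoid

abbrev GG : Type := Monoid.Coprod (Multiplicative (ZMod 2)) (Multiplicative (ZMod 3))

def zhom {H : Type*} [Group H] (n : ℕ) (x : H) (hx : x ^ n = 1) : Multiplicative (ZMod n) →* H :=
  AddMonoidHom.toMultiplicativeLeft (ZMod.lift n ⟨zmultiplesHom (Additive H) (Additive.ofMul x), by
    simpa using congrArg Additive.ofMul hx⟩)

theorem zhom_one {H : Type*} [Group H] (n : ℕ) (x : H) (hx : x ^ n = 1) :
    zhom n x hx (Multiplicative.ofAdd 1) = x := by
  have : (1 : ZMod n) = ((1 : ℤ) : ZMod n) := by simp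
  simp only [zhom, AddMonoidHom.coe_toMultiplicativeLeft, Function.comp_apply, toAdd_ofAdd]
  rw [this, ZMod.lift_coe]
  simp

theorem zhom_ext {H : Type*} [Group H] (n : ℕ) (φ ψ : Multiplicative (ZMod n) →* H)
    (h : φ (Multiplicative.ofAdd 1) = ψ (Multiplicative.ofAdd 1)) : φ = ψ := by
  refine MonoidHom.ext fun z => ?_
  obtain ⟨k, hk⟩ := ZMod.intCast_surjective (Multiplicative.toAdd z)
  have : z = Multiplicative.ofAdd (1 : ZMod n) ^ k := by
    rw [← ofAdd_zsmul]; simp [hk]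
  rw [this, map_zpow, map_zpow, h]

theorem main_oo : Nonempty (FundamentalGroup UU oo ≃* GG) := by
  let A : FundamentalGroup UU oo := FundamentalGroup.fromPath alp
  let B : FundamentalGroup UU oo := FundamentalGroup.fromPath bet
  have hA : A ^ 2 = 1 := by rw [pow_two]; exact alp2
  have hB : B ^ 3 = 1 := by rw [pow_succ', pow_two]
                            exact (Path.Homotopic.Quotient.trans_assoc _ _ _).trans bet3
  let a : GG := Coprod.inl (Multiplicative.ofAdd 1)
  let b : GG := Coprod.inr (Multiplicative.ofAdd 1)
  have ha : a * a = 1 := by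
    simp only [a]
    rw [← map_mul, ← map_one Coprod.inl]
    exact congrArg _ (by decide)
  have hb : b * b * b = 1 := by
    simp only [b]
    rw [← map_mul, ← map_mul, ← map_one Coprod.inr]
    exact congrArg _ (by decide)
  obtain ⟨M, hMA, hMB⟩ := monodromy ha hb
  let φ : GG →* FundamentalGroup UU oo := Coprod.lift (zhom 2 A hA) (zhom 3 B hB)
  have φa : φ a = A := by simp only [φ, a, Coprod.lift_apply_inl, zhom_one]
  have φb : φ b = B := by simp only [φ, b, Coprod.lift_apply_inr, zhom_one]
  have hcomp : M.comp φ = MulAction.toPermHom GG GG := by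
    apply Coprod.hom_ext
    · apply zhom_ext
      ext g : 1
      change M (φ a) g = a * g
      rw [φa]; exact hMA g
    · apply zhom_ext
      ext g : 1
      change M (φ b) g = b * g
      rw [φb]; exact hMB g
  have hinj : Function.Injective φ := by
    intro x y hxy
    have h1 : M.comp φ x = M.comp φ y := congrArg M hxy
    rw [hcomp] at h1
    have := congrArg (fun e : Equiv.Perm GG => e 1) h1
    simpa using this
  have hsurj : Function.Surjective φ := by
    intro c
    refine generation (Hs := fun c => ∃ x, φ x = FundamentalGroup.fromPath c) ⟨1, map_one φ⟩ ?_ ?_ c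
    · rintro h ⟨x, hx⟩
      refine ⟨a⁻¹ * x, ?_⟩
      rw [map_mul, map_inv, φa, hx]; rfl
    · rintro h ⟨x, hx⟩
      refine ⟨b⁻¹ * x, ?_⟩
      rw [map_mul, map_inv, φb, hx]; rfl
  exact ⟨(MulEquiv.ofBijective φ ⟨hinj, hsurj⟩).symm⟩

theorem main_UU (S : Set P2) (hS : S = UU) (x : S) : Nonempty (FundamentalGroup S x ≃* GG) := by
  subst hS
  obtain ⟨e⟩ := main_oo
  exact ⟨(FundamentalGroup.fundamentalGroupMulEquivOfPath (PathConnectedSpace.somePath x oo)).trans e⟩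

theorem compl_eq_UU : (V ((MvPolynomial.X 0 * MvPolynomial.X 1) ^ 3 +
    (MvPolynomial.X 1 ^ 2 * MvPolynomial.X 2 - MvPolynomial.X 1 ^ 3 - MvPolynomial.X 0 ^ 3) ^ 2))ᶜ
    = UU := by
  ext p
  simp [V, UU, DD, f2, f3]

end Fin

end Helpers

/-- For `f₂ = xy` and `f₃ = y²z − y³ − x³` (with `x = X 0`, `y = X 1`,
`z = X 2`), the sextic `C = V(f₂³ + f₃²)` (a maximal tame torus sextic with configuration of
singularities `[Sp₁, A₂]`) satisfies `π₁(ℙ² \ C) ≅ ℤ₂ * ℤ₃`. -/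
theorem stmt_13 (f₂ f₃ : MvPolynomial (Fin 3) ℂ)
    (hf₂ : f₂ = X 0 * X 1)
    (hf₃ : f₃ = X 1 ^ 2 * X 2 - X 1 ^ 3 - X 0 ^ 3) :
    ∀ x : ↥(V (f₂ ^ 3 + f₃ ^ 2))ᶜ,
      Nonempty (FundamentalGroup (↥(V (f₂ ^ 3 + f₃ ^ 2))ᶜ) x ≃*
        Monoid.Coprod (Multiplicative (ZMod 2)) (Multiplicative (ZMod 3))) := by
  subst hf₂ hf₃
  exact fun x => main_UU _ compl_eq_UU x
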